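/- arXiv:2109.13583 — 2 statements merged into one kernel-verified Lean document; each statement's English description precedes it below -/
import Mathlib

section
/- On the hexagonal lattice with L ≥ 8: suppose σ ∈ X is of type (MB), i.e., σ is cross-free with H(σ) = 2L+2 and all bridges of σ are parallel and of the same spin a ∈ Ω. Then exactly one of the following holds: (⋆) there exists a (2L+2)-path (ω_n)_{n=0}^N from σ to the ground state 𝐚 with N ≤ 4L such that every configuration ω_n on the path has at least L−2 a-bridges; or (⋆⋆) σ is isolated, in the sense that N̂(σ) = {σ}. -/
open scoped Classical BigOperators

namespace IsingHex

/-- Sites of the hexagonal lattice of side length `L` with periodic boundary conditions,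
identified with the `2L²` triangular faces of the dual triangular lattice `Λ*`:
`(p, false)` is the up-triangle and `(p, true)` the down-triangle in the rhombic cell `p`. -/
abbrev Site (L : ℕ) : Type := (ZMod L × ZMod L) × Bool

/-- Spin configurations `X = Ω^Λ` with spin set `Ω = Fin q`. -/
abbrev Conf (L q : ℕ) : Type := Site L → Fin q

/-- Adjacency of the hexagonal lattice: the up-triangle `(p, false)` is adjacent to the
down-triangles `(p, true)`, `(p - (1,0), true)` and `(p - (0,1), true)`. -/
def hexAdj {L : ℕ} (v w : Site L) : Prop :=
  (v.2 = false ∧ w.2 = true ∧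
     (w.1 = v.1 ∨ w.1 = (v.1.1 - 1, v.1.2) ∨ w.1 = (v.1.1, v.1.2 - 1))) ∨
  (v.2 = true ∧ w.2 = false ∧
     (v.1 = w.1 ∨ v.1 = (w.1.1 - 1, w.1.2) ∨ v.1 = (w.1.1, w.1.2 - 1)))

/-- The Hamiltonian `H(σ)`: the number of edges of `Λ` whose endpoints carry different
spins; each edge is counted exactly once through its unique up-triangle endpoint. -/
noncomputable def Ham (L q : ℕ) (σ : Conf L q) : ℕ :=
  Nat.card {e : Site L × Site L // e.1.2 = false ∧ hexAdj e.1 e.2 ∧ σ e.1 ≠ σ e.2}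

/-- The monochromatic ground state `𝐚`. -/
def groundConf (L q : ℕ) (a : Fin q) : Conf L q := fun _ => a

/-- The set `S = {𝟏, …, 𝐪}` of ground states. -/
def groundSet (L q : ℕ) : Set (Conf L q) := {σ | ∃ a : Fin q, σ = groundConf L q a}

/-- Partition function `Z_β`. -/
noncomputable def Zfun (L q : ℕ) (β : ℝ) : ℝ :=
  ∑' σ : Conf L q, Real.exp (-β * (Ham L q σ : ℝ))

/-- Gibbs measure of a set of configurations. -/
noncomputable def gibbsP (L q : ℕ) (β : ℝ) (A : Set (Conf L q)) : ℝ :=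
  (∑' σ : Conf L q, A.indicator (fun ζ => Real.exp (-β * (Ham L q ζ : ℝ))) σ) / Zfun L q β

/-- `σ ∼ ζ`: the two configurations differ at exactly one site. -/
def oneFlip {L q : ℕ} (σ ζ : Conf L q) : Prop :=
  ∃ x : Site L, σ x ≠ ζ x ∧ ∀ y : Site L, y ≠ x → σ y = ζ y

/-- Metropolis jump rates `c_β(σ, ζ)`. -/
noncomputable def rate (L q : ℕ) (β : ℝ) (σ ζ : Conf L q) : ℝ :=
  if oneFlip σ ζ then Real.exp (-β * max ((Ham L q ζ : ℝ) - (Ham L q σ : ℝ)) 0) else 0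

/-- There is a `t`-path of single spin flips connecting `σ` and `ζ`. -/
def ConnBelow (L q : ℕ) (t : ℕ) (σ ζ : Conf L q) : Prop :=
  ∃ (N : ℕ) (ω : ℕ → Conf L q), ω 0 = σ ∧ ω N = ζ ∧
    (∀ n < N, oneFlip (ω n) (ω (n + 1))) ∧ ∀ n ≤ N, Ham L q (ω n) ≤ t

/-- Communication height `Φ(σ, ζ)`. -/
noncomputable def commHeight (L q : ℕ) (σ ζ : Conf L q) : ℕ :=
  sInf {t : ℕ | ConnBelow L q t σ ζ}

/-- The strip of index `ℓ` in direction `d` (`0` = horizontal, `1` = vertical,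
`2` = diagonal): `2L` consecutive triangles winding around the torus. -/
def stripSet (L : ℕ) (d : Fin 3) (ℓ : ZMod L) : Set (Site L) :=
  if d = 0 then {v | v.1.2 = ℓ}
  else if d = 1 then {v | v.1.1 = ℓ}
  else {v | (v.2 = false ∧ v.1.1 + v.1.2 = ℓ) ∨ (v.2 = true ∧ v.1.1 + v.1.2 = ℓ - 1)}

/-- Strip energy `ΔH_s(σ)`: number of adjacent pairs inside the strip with different spins. -/
noncomputable def stripEnergy (L q : ℕ) (σ : Conf L q) (d : Fin 3) (ℓ : ZMod L) : ℕ :=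
  Nat.card {e : Site L × Site L //
    e.1.2 = false ∧ e.1 ∈ stripSet L d ℓ ∧ e.2 ∈ stripSet L d ℓ ∧
      hexAdj e.1 e.2 ∧ σ e.1 ≠ σ e.2}

/-- The strip `(d, ℓ)` is an `a`-bridge of `σ`. -/
def IsBridgeWith (L q : ℕ) (σ : Conf L q) (d : Fin 3) (ℓ : ZMod L) (a : Fin q) : Prop :=
  ∀ v ∈ stripSet L d ℓ, σ v = a

/-- The strip `(d, ℓ)` is a bridge of `σ`. -/
def IsBridge (L q : ℕ) (σ : Conf L q) (d : Fin 3) (ℓ : ZMod L) : Prop :=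
  ∃ a : Fin q, IsBridgeWith L q σ d ℓ a

/-- Cyclic enumeration of the strip `(d, ℓ)` by `ZMod (2L)`, consecutive triangles
being adjacent. -/
def stripCycle (L : ℕ) (d : Fin 3) (ℓ : ZMod L) (k : ZMod (2 * L)) : Site L :=
  let t : ZMod L := ((k.val / 2 : ℕ) : ZMod L)
  if d = 0 then ((t, ℓ), decide (k.val % 2 = 1))
  else if d = 1 then ((ℓ, t), decide (k.val % 2 = 1))
  else if k.val % 2 = 1 then ((t, ℓ - 1 - t), true) else ((t, ℓ - t), false)

/-- A set of triangles is an arc (a set of consecutive triangles) of the strip `(d, ℓ)`. -/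
def IsArc (L : ℕ) (d : Fin 3) (ℓ : ZMod L) (S : Set (Site L)) : Prop :=
  ∃ (s : ZMod (2 * L)) (m : ℕ),
    S = (fun k : ℕ => stripCycle L d ℓ (s + (k : ZMod (2 * L)))) '' Set.Iio m

/-- The strip `(d, ℓ)` is an `{a,b}`-semibridge of `σ`: it carries exactly the two
spins `a ≠ b`, and the sites carrying each spin are consecutive in the strip. -/
def IsSemibridgePair (L q : ℕ) (σ : Conf L q) (d : Fin 3) (ℓ : ZMod L) (a b : Fin q) : Prop :=
  a ≠ b ∧ (∀ v ∈ stripSet L d ℓ, σ v = a ∨ σ v = b) ∧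
    (∃ v ∈ stripSet L d ℓ, σ v = a) ∧ (∃ v ∈ stripSet L d ℓ, σ v = b) ∧
    IsArc L d ℓ {v ∈ stripSet L d ℓ | σ v = a} ∧ IsArc L d ℓ {v ∈ stripSet L d ℓ | σ v = b}

/-- The strip `(d, ℓ)` is a semibridge of `σ`. -/
def IsSemibridge (L q : ℕ) (σ : Conf L q) (d : Fin 3) (ℓ : ZMod L) : Prop :=
  ∃ a b : Fin q, IsSemibridgePair L q σ d ℓ a b

/-- `σ` has an `a`-cross: two `a`-bridges in different directions. -/
def HasCross (L q : ℕ) (σ : Conf L q) (a : Fin q) : Prop :=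
  ∃ (d d' : Fin 3) (ℓ ℓ' : ZMod L),
    d ≠ d' ∧ IsBridgeWith L q σ d ℓ a ∧ IsBridgeWith L q σ d' ℓ' a

/-- `σ` is cross-free. -/
def CrossFree (L q : ℕ) (σ : Conf L q) : Prop := ∀ a : Fin q, ¬ HasCross L q σ a

/-- Connected subsets of the torus `𝕋_L` of strip indices (the collection `𝔖_L`). -/
def CircConn (L : ℕ) (P : Set (ZMod L)) : Prop :=
  ∀ x ∈ P, ∀ y ∈ P, ∃ (N : ℕ) (γ : ℕ → ZMod L), γ 0 = x ∧ γ N = y ∧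
    (∀ n ≤ N, γ n ∈ P) ∧ ∀ n < N, γ (n + 1) = γ n + 1 ∨ γ (n + 1) = γ n - 1

/-- Union of the strips with indices in `P`, in direction `d`. -/
def stripUnion (L : ℕ) (d : Fin 3) (P : Set (ZMod L)) : Set (Site L) :=
  ⋃ ℓ ∈ P, stripSet L d ℓ

/-- The configuration `ξ^{a,b}_U`: spin `b` on `U` and spin `a` elsewhere. -/
noncomputable def xiConf (L q : ℕ) (a b : Fin q) (U : Set (Site L)) : Conf L q :=
  fun v => if v ∈ U then b else a

/-- `σ ∈ R_n^{a,b}`: a regular configuration between `𝐚` and `𝐛` built from `n` strips. -/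
def IsRegular (L q : ℕ) (σ : Conf L q) (a b : Fin q) (n : ℕ) : Prop :=
  ∃ (d : Fin 3) (P : Set (ZMod L)), CircConn L P ∧ P.ncard = n ∧
    σ = xiConf L q a b (stripUnion L d P)

/-- The vertices (in the triangular lattice) of the triangle `v`. -/
def triVerts (L : ℕ) (v : Site L) : Set (ZMod L × ZMod L) :=
  if v.2 = false then {v.1, (v.1.1 + 1, v.1.2), (v.1.1, v.1.2 + 1)}
  else {(v.1.1 + 1, v.1.2), (v.1.1, v.1.2 + 1), (v.1.1 + 1, v.1.2 + 1)}

/-- A connected set of triangles (connected through shared sides). -/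
def ConnSet (L : ℕ) (U : Set (Site L)) : Prop :=
  ∀ x ∈ U, ∀ y ∈ U, ∃ (N : ℕ) (γ : ℕ → Site L), γ 0 = x ∧ γ N = y ∧
    (∀ n ≤ N, γ n ∈ U) ∧ ∀ n < N, hexAdj (γ n) (γ (n + 1))

/-- A one-dimensional canonical set inside the strip `(d, ℓ)`. -/
def OneDimCanonical (L : ℕ) (d : Fin 3) (ℓ : ZMod L) (U : Set (Site L)) : Prop :=
  U ⊆ stripSet L d ℓ ∧ U.Nonempty ∧ U ≠ stripSet L d ℓ ∧
  (ConnSet L U ∨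
    (Even U.ncard ∧ ∃ (U₁ : Set (Site L)) (y : Site L),
      U = U₁ ∪ {y} ∧ y ∉ U₁ ∧ U₁.Nonempty ∧ ConnSet L U₁ ∧
      (∀ x ∈ U₁, ¬ hexAdj x y) ∧ ∃ x ∈ U₁, (triVerts L x ∩ triVerts L y).Nonempty))

/-- `P ≺ P'`: connected index sets with `P ⊆ P'` and `|P'| = |P| + 1`. -/
def StepPair (L : ℕ) (P P' : Set (ZMod L)) : Prop :=
  CircConn L P ∧ CircConn L P' ∧ P ⊆ P' ∧ P'.ncard = P.ncard + 1

/-- A protuberance attached to `s(P)` inside the strip `(d, ℓ)`: a one-dimensional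
canonical set such that, when `1 ≤ |P| ≤ L-2`, at least half of its triangles share a
side with `s(P)`. -/
def IsProtuberance (L : ℕ) (d : Fin 3) (P : Set (ZMod L)) (ℓ : ZMod L)
    (U : Set (Site L)) : Prop :=
  OneDimCanonical L d ℓ U ∧
    (1 ≤ P.ncard → P.ncard ≤ L - 2 →
      U.ncard ≤ 2 * {x ∈ U | ∃ y ∈ stripUnion L d P, hexAdj x y}.ncard)

/-- `‖σ‖_a`: the number of sites with spin `a`. -/
noncomputable def spinCount (L q : ℕ) (σ : Conf L q) (a : Fin q) : ℕ :=
  Nat.card {x : Site L // σ x = a}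

/-- `N̂(S)`: configurations connected to a ground state by a `(2L+2)`-path. -/
def NHatGround (L q : ℕ) : Set (Conf L q) :=
  {ζ | ∃ a : Fin q, ConnBelow L q (2 * L + 2) (groundConf L q a) ζ}

/-- A nice pair of configurations (relative to the partition class `A`). -/
def NicePair (L q : ℕ) (A : Finset (Fin q)) (σ ζ : Conf L q) : Prop :=
  σ ∉ NHatGround L q ∧ ζ ∉ NHatGround L q ∧ oneFlip σ ζ ∧
    (∑ a ∈ A, spinCount L q σ a) = L ^ 2 ∧ (∑ a ∈ A, spinCount L q ζ a) = L ^ 2 - 1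

/-- `u` is the vector of mean hitting times `σ ↦ E_σ[τ_A]` of the Metropolis dynamics:
it vanishes on `A` and satisfies the first-step (harmonicity) equations off `A`. -/
def IsMeanHittingTime (L q : ℕ) (β : ℝ) (A : Set (Conf L q)) (u : Conf L q → ℝ) : Prop :=
  (∀ σ ∈ A, u σ = 0) ∧
    ∀ σ ∉ A, (∑' ζ : Conf L q, rate L q β σ ζ) * u σ =
      1 + ∑' ζ : Conf L q, rate L q β σ ζ * u ζ

/-- Gibbs weight `μ_β(σ)`. -/
noncomputable def gibbsWeight (L q : ℕ) (β : ℝ) (σ : Conf L q) : ℝ :=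
  Real.exp (-β * (Ham L q σ : ℝ)) / Zfun L q β

/-- The Dirichlet form `D_β(f)`. -/
noncomputable def dirichletForm (L q : ℕ) (β : ℝ) (f : Conf L q → ℝ) : ℝ :=
  (1 / 2) * ∑' p : Conf L q × Conf L q,
    gibbsWeight L q β p.1 * rate L q β p.1 p.2 * (f p.2 - f p.1) ^ 2

/-- `h` is the equilibrium potential `h^β_{A,B}(σ) = P_σ[τ_A < τ_B]`: it equals `1` on
`A`, `0` on `B`, and is harmonic for the Metropolis dynamics off `A ∪ B`. -/
def IsEqPotential (L q : ℕ) (β : ℝ) (A B : Set (Conf L q)) (h : Conf L q → ℝ) : Prop :=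
  (∀ σ ∈ A, h σ = 1) ∧ (∀ σ ∈ B, h σ = 0) ∧
    ∀ σ, σ ∉ A → σ ∉ B → (∑' ζ : Conf L q, rate L q β σ ζ * (h σ - h ζ)) = 0



/-- Disagreement indicator. -/
def DD {q : ℕ} (x y : Fin q) : ℕ := if x = y then 0 else 1

lemma DD_le {q : ℕ} (x y : Fin q) : DD x y ≤ 1 := by unfold DD; split_ifs <;> simp
lemma DD_self {q : ℕ} (x : Fin q) : DD x x = 0 := by simp [DD]
lemma DD_ne {q : ℕ} {x y : Fin q} (h : x ≠ y) : DD x y = 1 := by simp [DD, h]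
lemma DD_eq {q : ℕ} {x y : Fin q} (h : x = y) : DD x y = 0 := by simp [DD, h]

lemma hexAdj_symm {L : ℕ} {v w : Site L} (h : hexAdj v w) : hexAdj w v := by
  unfold hexAdj at *; tauto

lemma hexAdj_ne {L : ℕ} {v w : Site L} (h : hexAdj v w) : v.2 ≠ w.2 := by
  unfold hexAdj at h; grind

lemma Ham_eq (L q : ℕ) [NeZero L] (σ : Conf L q) :
    Ham L q σ = ∑ e ∈ (Finset.univ : Finset (Site L × Site L)).filter
      (fun e => e.1.2 = false ∧ hexAdj e.1 e.2), DD (σ e.1) (σ e.2) := by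
  unfold Ham DD
  rw [Nat.card_eq_fintype_card, Fintype.card_subtype, Finset.card_filter, Finset.sum_filter]
  apply Finset.sum_congr rfl
  intro e _
  by_cases h1 : e.1.2 = false <;> by_cases h2 : hexAdj e.1 e.2 <;>
    by_cases h3 : σ e.1 = σ e.2 <;> simp [h1, h2, h3]

lemma ham_split (L q : ℕ) [NeZero L] (σ : Conf L q) (v x y z : Site L)
    (hn : ∀ w, hexAdj v w ↔ w = x ∨ w = y ∨ w = z) (hxy : x ≠ y) (hxz : x ≠ z) (hyz : y ≠ z) :
    ∃ R : ℕ, ∀ b : Fin q, Ham L q (Function.update σ v b) =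
      R + (DD b (σ x) + DD b (σ y) + DD b (σ z)) := by
  set S := (Finset.univ : Finset (Site L × Site L)).filter
      (fun e => e.1.2 = false ∧ hexAdj e.1 e.2) with hS
  have hvx : hexAdj v x := (hn x).2 (by simp)
  have hvy : hexAdj v y := (hn y).2 (by simp)
  have hvz : hexAdj v z := (hn z).2 (by simp)
  have nx : x ≠ v := fun h => hexAdj_ne hvx (by rw [h])
  have ny : y ≠ v := fun h => hexAdj_ne hvy (by rw [h])
  have nz : z ≠ v := fun h => hexAdj_ne hvz (by rw [h])
  refine ⟨∑ e ∈ S.filter (fun e => ¬ (e.1 = v ∨ e.2 = v)), DD (σ e.1) (σ e.2), fun b => ?_⟩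
  rw [Ham_eq, ← hS, ← Finset.sum_filter_add_sum_filter_not S (fun e => (e.1 = v ∨ e.2 = v)), add_comm]
  congr 1
  · apply Finset.sum_congr rfl
    intro e he
    simp only [Finset.mem_filter, not_or] at he
    rw [Function.update_of_ne he.2.1, Function.update_of_ne he.2.2]
  · cases hv : v.2
    · have : S.filter (fun e => (e.1 = v ∨ e.2 = v)) = {(v, x), (v, y), (v, z)} := by
        ext ⟨e1, e2⟩
        simp only [hS, Finset.mem_filter, Finset.mem_univ, true_and, Finset.mem_insert,
          Finset.mem_singleton, Prod.mk.injEq]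
        constructor
        · rintro ⟨⟨h1, h2⟩, h3⟩
          have h4 : e1 = v := by
            rcases h3 with h3 | h3
            · exact h3
            · exfalso; apply hexAdj_ne h2; rw [h1, h3, hv]
          subst h4
          have := (hn e2).1 h2
          tauto
        · rintro (⟨h1, h2⟩ | ⟨h1, h2⟩ | ⟨h1, h2⟩) <;> subst h1 <;> subst h2 <;> simp [*]
      rw [this, Finset.sum_insert (by simp [hxy, hxz]), Finset.sum_insert (by simp [hyz]),
        Finset.sum_singleton]
      simp only [Function.update_self, Function.update_of_ne nx, Function.update_of_ne ny,
        Function.update_of_ne nz]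
      ring
    · have : S.filter (fun e => (e.1 = v ∨ e.2 = v)) = {(x, v), (y, v), (z, v)} := by
        ext ⟨e1, e2⟩
        simp only [hS, Finset.mem_filter, Finset.mem_univ, true_and, Finset.mem_insert,
          Finset.mem_singleton, Prod.mk.injEq]
        constructor
        · rintro ⟨⟨h1, h2⟩, h3⟩
          have h4 : e2 = v := by
            rcases h3 with h3 | h3
            · exfalso; rw [h3, hv] at h1; cases h1
            · exact h3
          subst h4
          have := (hn e1).1 (hexAdj_symm h2)
          tauto
        · have hx2 := hexAdj_ne hvx
          have hy2 := hexAdj_ne hvy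
          have hz2 := hexAdj_ne hvz
          rw [hv] at hx2 hy2 hz2
          rintro (⟨h1, h2⟩ | ⟨h1, h2⟩ | ⟨h1, h2⟩) <;> subst h1 <;> subst h2
          · exact ⟨⟨by simpa using hx2.symm, hexAdj_symm hvx⟩, by simp⟩
          · exact ⟨⟨by simpa using hy2.symm, hexAdj_symm hvy⟩, by simp⟩
          · exact ⟨⟨by simpa using hz2.symm, hexAdj_symm hvz⟩, by simp⟩
      rw [this, Finset.sum_insert (by simp [hxy, hxz]), Finset.sum_insert (by simp [hyz]),
        Finset.sum_singleton]
      simp only [Function.update_self, Function.update_of_ne nx, Function.update_of_ne ny,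
        Function.update_of_ne nz]
      simp only [DD, eq_comm (b := b)]
      ring

lemma ham_flip (L q : ℕ) [NeZero L] (σ : Conf L q) (v x y z : Site L)
    (hn : ∀ w, hexAdj v w ↔ w = x ∨ w = y ∨ w = z) (hxy : x ≠ y) (hxz : x ≠ z) (hyz : y ≠ z)
    (b : Fin q) : Ham L q (Function.update σ v b) +
      (DD (σ v) (σ x) + DD (σ v) (σ y) + DD (σ v) (σ z)) =
      Ham L q σ + (DD b (σ x) + DD b (σ y) + DD b (σ z)) := by
  obtain ⟨R, hR⟩ := ham_split L q σ v x y z hn hxy hxz hyz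
  have h1 := hR b
  have h2 := hR (σ v)
  rw [Function.update_eq_self] at h2
  omega

lemma oneFlip_update {L q : ℕ} (σ : Conf L q) (v : Site L) (b : Fin q) (h : σ v ≠ b) :
    oneFlip σ (Function.update σ v b) :=
  ⟨v, by simpa using h, fun y hy => by rw [Function.update_of_ne hy]⟩

/-- Bounded-energy reachability through configurations equal to `a` outside `U`. -/
inductive Reach {L q : ℕ} (U : Set (Site L)) (a : Fin q) : ℕ → Conf L q → Conf L q → Prop
  | refl (n : ℕ) (σ : Conf L q) (h : Ham L q σ ≤ 2 * L + 2) (hU : ∀ v, v ∉ U → σ v = a) :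
      Reach U a n σ σ
  | step (n : ℕ) (σ ζ τ : Conf L q) (h : Ham L q σ ≤ 2 * L + 2) (hU : ∀ v, v ∉ U → σ v = a)
      (hf : oneFlip σ ζ) (hr : Reach U a n ζ τ) : Reach U a (n + 1) σ τ

lemma Reach.mono {L q : ℕ} {U : Set (Site L)} {a : Fin q} {n : ℕ} {σ τ : Conf L q}
    (h : Reach U a n σ τ) : ∀ m, n ≤ m → Reach U a m σ τ := by
  induction h with
  | refl n σ h hU => intro m _; exact Reach.refl m σ h hU
  | step n σ ζ τ h hU hf hr ih =>
    intro m hm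
    obtain ⟨k, rfl⟩ : ∃ k, m = k + 1 := ⟨m - 1, by omega⟩
    exact Reach.step k σ ζ τ h hU hf (ih k (by omega))

lemma Reach.trans {L q : ℕ} {U : Set (Site L)} {a : Fin q} {n m : ℕ} {σ τ ρ : Conf L q}
    (h : Reach U a n σ τ) (h' : Reach U a m τ ρ) : Reach U a (n + m) σ ρ := by
  induction h with
  | refl n σ h hU => exact h'.mono _ (by omega)
  | step n σ ζ τ h hU hf hr ih =>
    have := Reach.step _ σ ζ _ h hU hf (ih h')
    exact this.mono _ (by omega)

lemma Reach.path {L q : ℕ} {U : Set (Site L)} {a : Fin q} {n : ℕ} {σ τ : Conf L q}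
    (h : Reach U a n σ τ) : ∃ (N : ℕ) (ω : ℕ → Conf L q), N ≤ n ∧ ω 0 = σ ∧ ω N = τ ∧
      (∀ k < N, oneFlip (ω k) (ω (k + 1))) ∧ (∀ k ≤ N, Ham L q (ω k) ≤ 2 * L + 2) ∧
      (∀ k ≤ N, ∀ v, v ∉ U → ω k v = a) := by
  induction h with
  | refl n σ h hU => exact ⟨0, fun _ => σ, by simp, rfl, rfl, by simp, fun _ _ => h, fun _ _ => hU⟩
  | step n σ ζ τ h hU hf hr ih =>
    obtain ⟨N, ω, hN, h0, hend, hfl, hH, hUU⟩ := ih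
    refine ⟨N + 1, fun k => Nat.casesOn k σ ω, by omega, rfl, hend, ?_, ?_, ?_⟩
    · intro k hk
      cases k with
      | zero => simpa [h0] using hf
      | succ k => exact hfl k (by omega)
    · intro k hk
      cases k with
      | zero => exact h
      | succ k => exact hH k (by omega)
    · intro k hk
      cases k with
      | zero => exact hU
      | succ k => exact hUU k (by omega)


/-- A cyclic strip of sites `c` with third neighbours `t`. -/
structure IsRing (L : ℕ) (c t : ℤ → Site L) : Prop where
  adj : ∀ n v, hexAdj (c n) v ↔ v = c (n - 1) ∨ v = c (n + 1) ∨ v = t n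
  per : ∀ n, c (n + 2 * L) = c n
  inj : ∀ n k : ℤ, 0 < k → k < 2 * L → c (n + k) ≠ c n
  tne : ∀ n m, t n ≠ c m

lemma IsRing.neg {L : ℕ} {c t : ℤ → Site L} (R : IsRing L c t) :
    IsRing L (fun n => c (-n)) (fun n => t (-n)) where
  adj n v := by
    have := R.adj (-n) v
    rw [this, show -(n - 1) = -n + 1 by ring, show -(n + 1) = -n - 1 by ring]
    tauto
  per n := by
    have := R.per (-(n + 2 * L))
    rw [show -(n + 2 * (L : ℤ)) + 2 * L = -n by ring] at this
    exact this.symm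
  inj n k h0 h1 := by
    have := R.inj (-(n + k)) k h0 h1
    rw [show -(n + k) + k = -n by ring] at this
    exact this.symm
  tne n m := R.tne _ _

lemma IsRing.flip {L q : ℕ} [NeZero L] (hL : 8 ≤ L) {c t : ℤ → Site L} (R : IsRing L c t)
    (σ : Conf L q) (n : ℤ) (b : Fin q) :
    Ham L q (Function.update σ (c n) b) +
      (DD (σ (c n)) (σ (c (n - 1))) + DD (σ (c n)) (σ (c (n + 1))) + DD (σ (c n)) (σ (t n))) =
      Ham L q σ + (DD b (σ (c (n - 1))) + DD b (σ (c (n + 1))) + DD b (σ (t n))) := by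
  apply ham_flip L q σ (c n) _ _ _ (R.adj n)
  · have := R.inj (n - 1) 2 (by norm_num) (by omega)
    rw [show n - 1 + 2 = n + 1 by ring] at this
    exact this.symm
  · exact (R.tne _ _).symm
  · exact (R.tne _ _).symm

lemma IsRing.cover {L : ℕ} [NeZero L] {c t : ℤ → Site L} (R : IsRing L c t) (s n : ℤ) :
    ∃ k : ℤ, 0 ≤ k ∧ k < 2 * L ∧ c n = c (s + k) := by
  have hL : (0 : ℤ) < 2 * L := by have := NeZero.pos L; omega
  refine ⟨(n - s) % (2 * L), Int.emod_nonneg _ hL.ne', Int.emod_lt_of_pos _ hL, ?_⟩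
  have key : ∀ (z : ℤ) (m : ℤ), c (m + z * (2 * L)) = c m := by
    have hp : Function.Periodic c (2 * L : ℤ) := R.per
    intro z m
    have := hp.zsmul z m
    simpa using this
  have h := Int.emod_add_mul_ediv (n - s) (2 * L)
  have := key ((n - s) / (2 * L)) (s + (n - s) % (2 * L))
  rw [← this]
  congr 1
  linarith

lemma descend {L q : ℕ} [NeZero L] (hL : 8 ≤ L) {c t : ℤ → Site L} (R : IsRing L c t)
    (U : Set (Site L)) (a : Fin q) (_hcU : ∀ n, c n ∈ U) (r : ℕ) :
    ∀ (s : ℤ) (σ : Conf L q), r + 1 ≤ 2 * L → Ham L q σ ≤ 2 * L + 2 →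
      (∀ v, v ∉ U → σ v = a) → (∀ n, σ (t n) = a) → σ (c (s - 1)) = a →
      (∀ k : ℤ, r ≤ k → k < 2 * L → σ (c (s + k)) = a) →
      ∃ τ, Reach U a r σ τ ∧ Ham L q τ ≤ 2 * L + 2 ∧ (∀ n, τ (c n) = a) ∧
        (∀ v, (∀ n, v ≠ c n) → τ v = σ v) := by
  induction r with
  | zero =>
    intro s σ _ hH hU ht hs hk
    refine ⟨σ, Reach.refl _ _ hH hU, hH, fun n => ?_, fun _ _ => rfl⟩
    obtain ⟨k, h0, h1, h2⟩ := R.cover s n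
    rw [h2]; exact hk k (by simpa using h0) h1
  | succ r ih =>
    intro s σ hr hH hU ht hs hk
    by_cases hsa : σ (c s) = a
    · obtain ⟨τ, h1, h2⟩ := ih (s + 1) σ (by omega) hH hU ht (by simpa using hsa) (by
        intro k hk1 hk2
        by_cases h : k + 1 = 2 * L
        · rw [show s + 1 + k = s + 2 * L by omega, R.per]; exact hsa
        · rw [show s + 1 + k = s + (k + 1) by ring]
          exact hk _ (by push_cast; omega) (by omega))
      exact ⟨τ, h1.mono _ (by omega), h2⟩
    · have hfl := R.flip hL σ s a
      rw [ht, hs, DD_ne hsa, DD_self] at hfl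
      have := DD_le a (σ (c (s + 1)))
      have hm : ∀ v, σ v = a → Function.update σ (c s) a v = a := by
        intro v hv; by_cases h : v = c s
        · rw [h]; simp
        · rw [Function.update_of_ne h, hv]
      have hH' : Ham L q (Function.update σ (c s) a) ≤ 2 * L + 2 := by omega
      obtain ⟨τ, h1, h2, h3, h4⟩ := ih (s + 1) (Function.update σ (c s) a) (by omega) hH'
        (fun v hv => hm v (hU v hv)) (fun n => hm _ (ht n)) (by simp) (by
        intro k hk1 hk2
        by_cases h : k + 1 = 2 * L
        · rw [show s + 1 + k = s + 2 * L by omega, R.per]; simp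
        · rw [show s + 1 + k = s + (k + 1) by ring]
          exact hm _ (hk _ (by push_cast; omega) (by omega)))
      refine ⟨τ, Reach.step _ _ _ _ hH hU (oneFlip_update σ _ _ hsa) h1, h2, h3, fun v hv => ?_⟩
      rw [h4 v hv, Function.update_of_ne (hv s)]

/-- From a ring containing an `a` and surrounded by `a`, erase it. -/
lemma descend' {L q : ℕ} [NeZero L] (hL : 8 ≤ L) {c t : ℤ → Site L} (R : IsRing L c t)
    (U : Set (Site L)) (a : Fin q) (hcU : ∀ n, c n ∈ U) (σ : Conf L q)
    (hH : Ham L q σ ≤ 2 * L + 2)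
    (hU : ∀ v, v ∉ U → σ v = a) (ht : ∀ n, σ (t n) = a) (s : ℤ) (hs : σ (c s) = a) :
      ∃ τ, Reach U a (2 * L - 1) σ τ ∧ Ham L q τ ≤ 2 * L + 2 ∧ (∀ n, τ (c n) = a) ∧
        (∀ v, (∀ n, v ≠ c n) → τ v = σ v) := by
  apply descend hL R U a hcU (2 * L - 1) (s + 1) σ (by omega) hH hU ht (by simpa using hs)
  intro k h1 h2
  rw [show s + 1 + k = s + 2 * L by omega, R.per, hs]

lemma sweep {L q : ℕ} [NeZero L] (hL : 8 ≤ L) {c t : ℤ → Site L} (R : IsRing L c t)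
    (U : Set (Site L)) (a : Fin q) (_hcU : ∀ n, c n ∈ U) (r : ℕ) :
    ∀ (s : ℤ) (σ : Conf L q), r + 1 ≤ 2 * L → Ham L q σ ≤ 2 * L + 2 →
      (s % 2 = 1 → Ham L q σ ≤ 2 * L + 1) →
      (∀ v, v ∉ U → σ v = a) → (∀ n, n % 2 = 0 → σ (t n) = a) → σ (c (s - 1)) = a →
      (∀ k : ℤ, 0 ≤ k → k < r → σ (c (s + k)) ≠ a) →
      (∀ k : ℤ, r ≤ k → k < 2 * L → σ (c (s + k)) = a) →
      ∃ τ, Reach U a r σ τ ∧ ((r = 0 ∧ τ = σ) ∨ Ham L q τ ≤ 2 * L + 1) ∧ (∀ n, τ (c n) = a) ∧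
        (∀ v, (∀ n, v ≠ c n) → τ v = σ v) := by
  induction r with
  | zero =>
    intro s σ _ hH _ hU ht hs _ hk
    refine ⟨σ, Reach.refl _ _ hH hU, Or.inl ⟨rfl, rfl⟩, fun n => ?_, fun _ _ => rfl⟩
    obtain ⟨k, h0, h1, h2⟩ := R.cover s n
    rw [h2]; exact hk k (by simpa using h0) h1
  | succ r ih =>
    intro s σ hr hH hodd hU ht hs hnon hk
    have hsa : σ (c s) ≠ a := by simpa using hnon 0 le_rfl (by push_cast; omega)
    have hfl := R.flip hL σ s a
    rw [hs, DD_ne hsa, DD_self] at hfl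
    have d1 := DD_le a (σ (c (s + 1)))
    have d2 := DD_le a (σ (t s))
    have hm : ∀ v, σ v = a → Function.update σ (c s) a v = a := by
      intro v hv; by_cases h : v = c s
      · rw [h]; simp
      · rw [Function.update_of_ne h, hv]
    have hev : s % 2 = 0 → Ham L q (Function.update σ (c s) a) ≤ 2 * L + 1 := by
      intro h
      rw [ht s h, DD_ne hsa, DD_self] at hfl
      omega
    have hod : s % 2 = 1 → Ham L q (Function.update σ (c s) a) ≤ 2 * L + 2 := by
      intro h
      have := hodd h
      omega
    have hH' : Ham L q (Function.update σ (c s) a) ≤ 2 * L + 2 := by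
      rcases Int.emod_two_eq_zero_or_one s with h | h
      · have := hev h; omega
      · exact hod h
    obtain ⟨τ, h1, h2, h3, h4⟩ := ih (s + 1) (Function.update σ (c s) a) (by omega) hH'
      (fun h => hev (by omega))
      (fun v hv => hm v (hU v hv)) (fun n hn => hm _ (ht n hn)) (by simp) (by
      intro k hk1 hk2
      have hne : c (s + (1 + k)) ≠ c s := R.inj s (1 + k) (by omega) (by omega)
      rw [show s + 1 + k = s + (1 + k) by ring, Function.update_of_ne hne]
      exact hnon _ (by omega) (by push_cast; omega)) (by
      intro k hk1 hk2
      by_cases h : k + 1 = 2 * L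
      · rw [show s + 1 + k = s + 2 * L by omega, R.per]; simp
      · rw [show s + 1 + k = s + (k + 1) by ring]
        exact hm _ (hk _ (by push_cast; omega) (by omega)))
    refine ⟨τ, Reach.step _ _ _ _ hH hU (oneFlip_update σ _ _ hsa) h1, Or.inr ?_, h3, fun v hv => ?_⟩
    · rcases h2 with ⟨h2, rfl⟩ | h2
      · rcases Int.emod_two_eq_zero_or_one s with h | h
        · exact hev h
        · have := hodd h
          have h5 := hk 1 (by push_cast; omega) (by omega)
          rw [h5, DD_ne hsa, DD_self] at hfl
          omega
      · exact h2
    · rw [h4 v hv, Function.update_of_ne (hv s)]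

/-- No three changes in one period. -/
def NoThree {q : ℕ} (M : ℤ) (f : ℤ → Fin q) : Prop :=
  ∀ s k₁ k₂ k₃ : ℤ, 0 ≤ k₁ → k₁ < k₂ → k₂ < k₃ → k₃ < M →
    f (s + k₁) ≠ f (s + k₁ + 1) → f (s + k₂) ≠ f (s + k₂ + 1) → f (s + k₃) ≠ f (s + k₃ + 1) → False

lemma NoThree.neg {q : ℕ} {M : ℤ} {f : ℤ → Fin q} (h : NoThree M f) :
    NoThree M (fun n => f (-n)) := by
  intro s k₁ k₂ k₃ h0 h1 h2 h3 e1 e2 e3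
  refine h (-(s + M)) (M - 1 - k₃) (M - 1 - k₂) (M - 1 - k₁) (by omega) (by omega) (by omega)
    (by omega) ?_ ?_ ?_
  · convert e3.symm using 2 <;> ring_nf
  · convert e2.symm using 2 <;> ring_nf
  · convert e1.symm using 2 <;> ring_nf

lemma arc {q : ℕ} {M : ℕ} {f : ℤ → Fin q} (hM : 2 ≤ M) (h : NoThree M f)
    (hp : ∀ n, f (n + M) = f n) (a : Fin q)
    (s : ℤ) (h0 : f (s - 1) = a) (h1 : f s ≠ a) :
    ∃ r : ℕ, 1 ≤ r ∧ r + 1 ≤ M ∧ (∀ k : ℤ, 0 ≤ k → k < r → f (s + k) ≠ a) ∧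
      (∀ k : ℤ, r ≤ k → k < M → f (s + k) = a) := by
  have hlast : f (s + (M - 1 : ℤ)) = a := by
    rw [show s + (M - 1 : ℤ) = s - 1 + M by ring, hp, h0]
  have hex : ∃ r : ℕ, f (s + r) = a := ⟨M - 1, by
    rw [Nat.cast_sub (by omega)]; simpa using hlast⟩
  have hr := Nat.find_spec hex
  have hmin := fun m => Nat.find_min hex (m := m)
  have hle : Nat.find hex ≤ M - 1 := Nat.find_min' hex (by
    rw [Nat.cast_sub (by omega)]; simpa using hlast)
  set r := Nat.find hex
  have hr1 : 1 ≤ r := by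
    by_contra hc
    have : r = 0 := by omega
    rw [this] at hr; simp at hr; exact h1 hr
  have hnon : ∀ k : ℤ, 0 ≤ k → k < r → f (s + k) ≠ a := by
    intro k hk1 hk2
    obtain ⟨m, rfl⟩ := Int.eq_ofNat_of_zero_le hk1
    exact hmin m (by exact_mod_cast hk2)
  refine ⟨r, hr1, by omega, hnon, ?_⟩
  have key : ∀ m : ℕ, (r + m : ℤ) < M → f (s + (r + m : ℤ)) = a := by
    intro m
    induction m with
    | zero => intro _; simpa using hr
    | succ m ih =>
      intro hm
      push_cast at hm
      have hi := ih (by omega)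
      by_contra hc
      refine h s (r - 1) (r + m) (M - 1) (by omega) (by omega) (by omega) (by omega) ?_ ?_ ?_
      · rw [show s + (r - 1 : ℤ) + 1 = s + r by ring, hr]
        exact hnon _ (by omega) (by omega)
      · rw [hi]; push_cast at hc; rw [← add_assoc] at hc
        intro h'; apply hc; rw [h']; congr 1; ring
      · rw [hlast, show s + (M - 1 : ℤ) + 1 = s + M by ring, hp]; exact h1.symm
  intro k hk1 hk2
  have := key (k - r).toNat (by omega)
  rwa [show (r + ((k - r).toNat : ℤ)) = k by omega] at this


lemma single_case {L q : ℕ} [NeZero L] (hL : 8 ≤ L) {c t : ℤ → Site L} (R : IsRing L c t)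
    (a : Fin q) (σ : Conf L q) (hH : Ham L q σ ≤ 2 * L + 2)
    (hout : ∀ v, (∀ n, v ≠ c n) → σ v = a) (hnc : ∃ n, σ (c n) ≠ σ (c (n + 1))) :
    Reach {v | ∃ n, v = c n} a (4 * L) σ (groundConf L q a) := by
  set U : Set (Site L) := {v | ∃ n, v = c n} with hUdef
  have hcU : ∀ n, c n ∈ U := fun n => ⟨n, rfl⟩
  have hU : ∀ v, v ∉ U → σ v = a := fun v hv => hout v (fun n h => hv ⟨n, h⟩)
  have ht : ∀ n, σ (t n) = a := fun n => hout _ (fun m => R.tne n m)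
  have fin : ∀ σ' : Conf L q, Ham L q σ' ≤ 2 * L + 2 → (∀ v, v ∉ U → σ' v = a) →
      (∃ n, σ' (c n) = a) → Reach U a (2 * L - 1) σ' (groundConf L q a) := by
    rintro σ' h1 h2 ⟨n, h3⟩
    obtain ⟨τ, e1, e2, e3, e4⟩ := descend' hL R U a hcU σ' h1 h2
      (fun n => h2 _ (by rintro ⟨m, hm⟩; exact R.tne n m hm)) n h3
    have : τ = groundConf L q a := by
      funext v
      by_cases hv : ∃ n, v = c n
      · obtain ⟨m, rfl⟩ := hv; exact e3 m
      · push Not at hv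
        rw [e4 v hv]; exact h2 v (fun ⟨m, hm⟩ => hv m hm)
    rwa [← this]
  by_cases hex : ∃ n, σ (c n) = a
  · exact (fin σ hH hU hex).mono _ (by omega)
  · push Not at hex
    obtain ⟨n, hn⟩ := hnc
    have hfl := R.flip hL σ n a
    rw [ht, DD_ne (hex n), DD_ne hn, DD_self] at hfl
    have d1 := DD_le a (σ (c (n - 1)))
    have d2 := DD_le a (σ (c (n + 1)))
    have := fin (Function.update σ (c n) a) (by omega) (fun v hv => by
      rw [Function.update_of_ne (fun h => hv ⟨n, h⟩)]; exact hU v hv) ⟨n, by simp⟩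
    exact (Reach.step _ _ _ _ hH hU (oneFlip_update σ _ _ (hex n)) this).mono _ (by omega)

lemma two_far {L q : ℕ} [NeZero L] (hL : 8 ≤ L) {A tA B tB : ℤ → Site L} (RA : IsRing L A tA)
    (RB : IsRing L B tB) (hAB : ∀ n m, A n ≠ B m) (U : Set (Site L))
    (hU0 : U = {v | (∃ n, v = A n) ∨ ∃ n, v = B n})
    (a : Fin q) (σ : Conf L q) (hH : Ham L q σ ≤ 2 * L + 2)
    (hout : ∀ v, v ∉ U → σ v = a)
    (hta : ∀ n, σ (tA n) = a) (htb : ∀ n m, tB n ≠ A m)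
    (hA : ∃ n, σ (A n) = a) (hB : ∃ n, σ (B n) = a) :
    Reach U a (2 * L - 1 + (2 * L - 1)) σ (groundConf L q a) := by
  obtain ⟨n, hA⟩ := hA
  obtain ⟨m, hB⟩ := hB
  have hAU : ∀ n, A n ∈ U := fun n => by rw [hU0]; exact Or.inl ⟨n, rfl⟩
  have hBU : ∀ n, B n ∈ U := fun n => by rw [hU0]; exact Or.inr ⟨n, rfl⟩
  obtain ⟨τ, e1, e2, e3, e4⟩ := descend' hL RA U a hAU σ hH hout hta n hA
  have o2 : ∀ v, v ∉ U → τ v = a := fun v hv => by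
    rw [e4 v (fun n h => hv (h ▸ hAU n))]; exact hout v hv
  have htb' : ∀ n, tB n ∉ U := by
    intro n h
    rw [hU0] at h
    rcases h with ⟨k, h⟩ | ⟨k, h⟩
    · exact htb _ _ h
    · exact RB.tne _ _ h
  obtain ⟨ρ, g1, g2, g3, g4⟩ := descend' hL RB U a hBU τ e2 o2 (fun n => o2 _ (htb' n)) m
    (by rw [e4 _ (fun n => (hAB n m).symm)]; exact hB)
  have : ρ = groundConf L q a := by
    funext v
    by_cases hv : ∃ n, v = B n
    · obtain ⟨k, rfl⟩ := hv; exact g3 k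
    · have hv' := hv
      push Not at hv'
      rw [g4 v hv']
      by_cases hw : ∃ n, v = A n
      · obtain ⟨k, rfl⟩ := hw; exact e3 k
      · apply o2; rw [hU0]; rintro (h | h)
        · exact hw h
        · exact hv h
  rw [← this]
  exact e1.trans g1

/-- Two adjacent strips. -/
structure Ladder (L : ℕ) (A tA B tB : ℤ → Site L) : Prop where
  rA : IsRing L A tA
  rB : IsRing L B tB
  disj : ∀ n m, A n ≠ B m
  oA : ∀ n, n % 2 = 1 → tA n = B n
  oB : ∀ n, n % 2 = 1 → tB n = A n
  eA : ∀ n, n % 2 = 0 → ∀ m, tA n ≠ B m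
  eB : ∀ n, n % 2 = 0 → ∀ m, tB n ≠ A m

lemma Ladder.swap {L : ℕ} {A tA B tB : ℤ → Site L} (h : Ladder L A tA B tB) :
    Ladder L B tB A tA :=
  ⟨h.rB, h.rA, fun n m => (h.disj m n).symm, h.oB, h.oA, h.eB, h.eA⟩

lemma Ladder.neg {L : ℕ} {A tA B tB : ℤ → Site L} (h : Ladder L A tA B tB) :
    Ladder L (fun n => A (-n)) (fun n => tA (-n)) (fun n => B (-n)) (fun n => tB (-n)) :=
  ⟨h.rA.neg, h.rB.neg, fun n m => h.disj _ _, fun n hn => h.oA _ (by omega),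
    fun n hn => h.oB _ (by omega), fun n hn m => h.eA _ (by omega) _,
    fun n hn m => h.eB _ (by omega) _⟩

/-- Constraints on the spins of two adjacent strips. -/
structure LState {q : ℕ} (M : ℤ) (a : Fin q) (f g : ℤ → Fin q) : Prop where
  nf : NoThree M f
  ng : NoThree M g
  cf : ∃ n, f n ≠ f (n + 1)
  cg : ∃ n, g n ≠ g (n + 1)
  w1 : ∀ n, f n ≠ a → f (n + 1) ≠ a → f n = f (n + 1)
  w1' : ∀ n, g n ≠ a → g (n + 1) ≠ a → g n = g (n + 1)
  w2 : ∀ n, n % 2 = 1 → f n ≠ a → g n ≠ a → f n = g n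
  w3 : ∀ n, n % 2 = 1 → f n = a → (f (n - 1) ≠ a ∨ f (n + 1) ≠ a) → g n = a
  w3' : ∀ n, n % 2 = 1 → g n = a → (g (n - 1) ≠ a ∨ g (n + 1) ≠ a) → f n = a

lemma LState.swap {q : ℕ} {M : ℤ} {a : Fin q} {f g : ℤ → Fin q} (h : LState M a f g) :
    LState M a g f :=
  ⟨h.ng, h.nf, h.cg, h.cf, h.w1', h.w1, fun n h1 h2 h3 => (h.w2 n h1 h3 h2).symm, h.w3', h.w3⟩

lemma LState.neg {q : ℕ} {M : ℤ} {a : Fin q} {f g : ℤ → Fin q} (h : LState M a f g) :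
    LState M a (fun n => f (-n)) (fun n => g (-n)) where
  nf := h.nf.neg
  ng := h.ng.neg
  cf := by
    obtain ⟨n, hn⟩ := h.cf
    exact ⟨-(n + 1), by simpa using hn.symm⟩
  cg := by
    obtain ⟨n, hn⟩ := h.cg
    exact ⟨-(n + 1), by simpa using hn.symm⟩
  w1 n h1 h2 := by
    have := h.w1 (-(n + 1)) h2
    rw [show -(n + 1) + 1 = -n by ring] at this
    exact (this h1).symm
  w1' n h1 h2 := by
    have := h.w1' (-(n + 1)) h2
    rw [show -(n + 1) + 1 = -n by ring] at this
    exact (this h1).symm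
  w2 n hn := h.w2 (-n) (by omega)
  w3 n hn h1 h2 := by
    apply h.w3 (-n) (by omega) h1
    rw [show -(n - 1) = -n + 1 by ring, show -(n + 1) = -n - 1 by ring] at h2
    tauto
  w3' n hn h1 h2 := by
    apply h.w3' (-n) (by omega) h1
    rw [show -(n - 1) = -n + 1 by ring, show -(n + 1) = -n - 1 by ring] at h2
    tauto

lemma LState.exists_a {q : ℕ} {M : ℤ} {a : Fin q} {f g : ℤ → Fin q} (h : LState M a f g) :
    ∃ n, f n = a := by
  by_contra hc
  push Not at hc
  obtain ⟨n, hn⟩ := h.cf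
  exact hn (h.w1 n (hc _) (hc _))

/-- A cyclic sequence with an `a` and a non-`a` has an `a` followed by a non-`a`. -/
lemma exists_start {q : ℕ} {M : ℕ} {f : ℤ → Fin q}
    (hp : ∀ n, f (n + M) = f n) (hM : 1 ≤ M) (a : Fin q) (h1 : ∃ n, f n = a) (h2 : ∃ n, f n ≠ a) :
    ∃ s, f (s - 1) = a ∧ f s ≠ a := by
  by_contra hc
  push Not at hc
  obtain ⟨n, hn⟩ := h1
  obtain ⟨m, hm⟩ := h2
  have key : ∀ k : ℕ, f (n + k) = a := by
    intro k
    induction k with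
    | zero => simpa using hn
    | succ k ih =>
      apply hc; rw [← ih]; congr 1; push_cast; ring
  have hP : Function.Periodic f (M : ℤ) := hp
  have h3 := hP.int_mul (|n| + |m|) m
  apply hm
  rw [← h3]
  have h4 : (0 : ℤ) ≤ m + (|n| + |m|) * M - n := by
    have : (|n| + |m|) * 1 ≤ (|n| + |m|) * (M : ℤ) := by
      apply mul_le_mul_of_nonneg_left (by exact_mod_cast hM) (by positivity)
    have := neg_abs_le m
    have := le_abs_self n
    linarith
  obtain ⟨k, hk⟩ := Int.eq_ofNat_of_zero_le h4
  have := key k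
  rw [← this]; congr 1
  push_cast
  simp only [Int.cast_id] at *
  linarith

lemma ladder_b {L q : ℕ} [NeZero L] (hL : 8 ≤ L) {A tA B tB : ℤ → Site L}
    (l : Ladder L A tA B tB) (U : Set (Site L))
    (hU0 : U = {v | (∃ n, v = A n) ∨ ∃ n, v = B n})
    (a : Fin q) (σ : Conf L q) (hH : Ham L q σ ≤ 2 * L + 2)
    (hout : ∀ v, v ∉ U → σ v = a)
    (S : LState (2 * L) a (fun n => σ (A n)) (fun n => σ (B n)))
    (n : ℤ) (hna : σ (A n) ≠ a) (hpr : σ (A (n - 1)) = a)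
    (h2 : σ (A (n + 1)) = a ∨ σ (tA n) = a) :
    Reach U a (4 * L) σ (groundConf L q a) := by
  have hAU : ∀ n, A n ∈ U := fun n => by rw [hU0]; exact Or.inl ⟨n, rfl⟩
  have hBU : ∀ n, B n ∈ U := fun n => by rw [hU0]; exact Or.inr ⟨n, rfl⟩
  obtain ⟨r, hr1, hr2, hr3, hr4⟩ := arc (M := 2 * L) (f := fun n => σ (A n)) (by omega)
    (by simpa using S.nf) (fun n => by simp [l.rA.per]) a n hpr hna
  have hfl := l.rA.flip hL σ n a
  have hH1 : Ham L q (Function.update σ (A n) a) ≤ 2 * L + 1 := by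
    have d1 := DD_le a (σ (A (n + 1)))
    have d2 := DD_le a (σ (tA n))
    rw [hpr, DD_ne hna, DD_self] at hfl
    rcases h2 with h2 | h2
    · rw [h2, DD_ne hna, DD_self] at hfl; omega
    · rw [h2, DD_ne hna, DD_self] at hfl; omega
  have hm : ∀ v, σ v = a → Function.update σ (A n) a v = a := by
    intro v hv; by_cases h : v = A n
    · rw [h]; simp
    · rw [Function.update_of_ne h, hv]
  have htA : ∀ n, n % 2 = 0 → tA n ∉ U := by
    intro n hn h
    rw [hU0] at h
    rcases h with ⟨k, h⟩ | ⟨k, h⟩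
    · exact l.rA.tne _ _ h
    · exact l.eA n hn _ h
  obtain ⟨τ, e1, e2, e3, e4⟩ := sweep hL l.rA U a hAU (r - 1) (n + 1) (Function.update σ (A n) a)
    (by omega) (by omega) (fun _ => hH1) (fun v hv => hm v (hout v hv))
    (fun n hn => hm _ (hout _ (htA n hn))) (by simp)
    (by
      intro k hk1 hk2
      have hne : A (n + (1 + k)) ≠ A n := l.rA.inj n (1 + k) (by omega) (by omega)
      rw [show n + 1 + k = n + (1 + k) by ring, Function.update_of_ne hne]
      exact hr3 _ (by omega) (by omega))
    (by
      intro k hk1 hk2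
      by_cases h : k + 1 = 2 * L
      · rw [show n + 1 + k = n + 2 * L by omega, l.rA.per]; simp
      · rw [show n + 1 + k = n + (k + 1) by ring]
        exact hm _ (hr4 _ (by omega) (by push_cast; omega)))
  have hHτ : Ham L q τ ≤ 2 * L + 2 := by
    rcases e2 with ⟨_, rfl⟩ | h <;> omega
  have o2 : ∀ v, v ∉ U → τ v = a := fun v hv => by
    rw [e4 v (fun n h => hv (h ▸ hAU n))]; exact hm _ (hout v hv)
  obtain ⟨m, hB⟩ := S.swap.exists_a
  have htB : ∀ n, τ (tB n) = a := by
    intro n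
    rcases Int.emod_two_eq_zero_or_one n with h | h
    · apply o2
      intro hh; rw [hU0] at hh
      rcases hh with ⟨k, hh⟩ | ⟨k, hh⟩
      · exact l.eB n h _ hh
      · exact l.rB.tne _ _ hh
    · rw [l.oB n h]; exact e3 n
  obtain ⟨ρ, g1, g2, g3, g4⟩ := descend' hL l.rB U a hBU τ hHτ o2 htB m
    (by rw [e4 _ (fun n => (l.disj n m).symm)]; exact hm _ hB)
  have : ρ = groundConf L q a := by
    funext v
    by_cases hv : ∃ n, v = B n
    · obtain ⟨k, rfl⟩ := hv; exact g3 k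
    · have hv' := hv
      push Not at hv'
      rw [g4 v hv']
      by_cases hw : ∃ n, v = A n
      · obtain ⟨k, rfl⟩ := hw; exact e3 k
      · apply o2; rw [hU0]; rintro (h | h)
        · exact hw h
        · exact hv h
  rw [← this]
  exact (Reach.step _ _ _ _ hH hout (oneFlip_update σ _ _ hna) (e1.trans g1)).mono _ (by omega)

lemma ladder_a {L q : ℕ} [NeZero L] (hL : 8 ≤ L) {A tA B tB : ℤ → Site L}
    (l : Ladder L A tA B tB) (U : Set (Site L))
    (hU0 : U = {v | (∃ n, v = A n) ∨ ∃ n, v = B n})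
    (a : Fin q) (σ : Conf L q) (hH : Ham L q σ ≤ 2 * L + 2)
    (hout : ∀ v, v ∉ U → σ v = a)
    (S : LState (2 * L) a (fun n => σ (A n)) (fun n => σ (B n)))
    (n : ℤ) (hna : σ (A n) = a) (hpr : σ (A (n - 1)) ≠ a)
    (hnx : σ (A (n + 1)) ≠ a) :
    Reach U a (4 * L) σ (groundConf L q a) := by
  have hAU : ∀ n, A n ∈ U := fun n => by rw [hU0]; exact Or.inl ⟨n, rfl⟩
  have hBU : ∀ n, B n ∈ U := fun n => by rw [hU0]; exact Or.inr ⟨n, rfl⟩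
  have perA : ∀ n, σ (A (n + (2 * L : ℕ))) = σ (A n) := fun n => by simp [l.rA.per]
  have perB : ∀ n, σ (B (n + (2 * L : ℕ))) = σ (B n) := fun n => by simp [l.rB.per]
  -- all other sites of `A` have a common spin
  obtain ⟨b, hb⟩ : ∃ b, σ (A (n + 1)) = b := ⟨_, rfl⟩
  have hall : ∀ k : ℕ, (k : ℤ) < 2 * L - 1 → σ (A (n + 1 + k)) = b := by
    intro k
    induction k with
    | zero => intro _; simpa using hb
    | succ k ih =>
      intro hk
      push_cast at hk
      have hi := ih (by omega)
      by_contra hc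
      refine S.nf (n - 1) 0 1 (k + 2) (by omega) (by omega) (by omega) (by omega) ?_ ?_ ?_
      · simpa [hna] using hpr
      · simpa [hna] using hnx.symm
      · show σ (A (n - 1 + (k + 2))) ≠ σ (A (n - 1 + (k + 2) + 1))
        rw [show n - 1 + ((k : ℤ) + 2) = n + 1 + k by ring, hi]
        push_cast at hc
        rw [show n + 1 + (k : ℤ) + 1 = n + 1 + (k + 1) by ring]
        exact fun h => hc h.symm
  have hprb : σ (A (n - 1)) = b := by
    have := hall (2 * L - 2) (by omega)
    rw [show n + 1 + ((2 * L - 2 : ℕ) : ℤ) = n - 1 + (2 * L : ℕ) by omega, perA] at this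
    exact this
  have hba : b ≠ a := hb ▸ hnx
  have hfl := l.rA.flip hL σ n b
  set σ' := Function.update σ (A n) b with hσ'
  have hH1 : Ham L q σ' ≤ 2 * L + 1 := by
    rw [hprb, hb, hna, DD_ne hba.symm, DD_self] at hfl
    have := DD_le b (σ (tA n))
    omega
  have hσB : ∀ m, σ' (B m) = σ (B m) := fun m => Function.update_of_ne (l.disj n m).symm _ _
  have hσA : ∀ m, σ' (A m) ≠ a := by
    intro m
    obtain ⟨k, k0, k1, hk⟩ := l.rA.cover (n + 1) m
    rw [hk]
    by_cases h : k = 2 * L - 1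
    · rw [show n + 1 + k = n + 2 * L by omega, l.rA.per]
      simpa [hσ'] using hba
    · have hne : A (n + (1 + k)) ≠ A n := l.rA.inj n (1 + k) (by omega) (by omega)
      rw [hσ', show n + 1 + k = n + (1 + k) by ring, Function.update_of_ne hne]
      obtain ⟨k', rfl⟩ := Int.eq_ofNat_of_zero_le k0
      have := hall k' (by omega)
      rw [show n + (1 + (k' : ℤ)) = n + 1 + k' by ring, this]
      exact hba
  have hout' : ∀ v, v ∉ U → σ' v = a := fun v hv => by
    have hne : v ≠ A n := fun h => hv (by rw [h]; exact hAU n)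
    rw [hσ', Function.update_of_ne hne]; exact hout v hv
  have htB : ∀ n, n % 2 = 0 → tB n ∉ U := by
    intro n hn h
    rw [hU0] at h
    rcases h with ⟨k, h⟩ | ⟨k, h⟩
    · exact l.eB n hn _ h
    · exact l.rB.tne _ _ h
  have htA : ∀ n, n % 2 = 0 → tA n ∉ U := by
    intro n hn h
    rw [hU0] at h
    rcases h with ⟨k, h⟩ | ⟨k, h⟩
    · exact l.rA.tne _ _ h
    · exact l.eA n hn _ h
  have hBn : ∃ m, σ (B m) ≠ a := by
    obtain ⟨m, hm⟩ := S.cg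
    by_contra hc
    push Not at hc
    exact hm (by simp [hc])
  obtain ⟨s, hs1, hs2⟩ := exists_start (f := fun m => σ (B m)) (M := 2 * L) perB (by omega) a
    S.swap.exists_a hBn
  obtain ⟨r, hr1, hr2, hr3, hr4⟩ := arc (M := 2 * L) (f := fun n => σ (B n)) (by omega)
    (by simpa using S.ng) perB a s hs1 hs2
  obtain ⟨τ, e1, e2, e3, e4⟩ := sweep hL l.rB U a hBU r s σ' hr2 (by omega) (fun _ => hH1) hout'
    (fun n hn => hout' _ (htB n hn)) (by rw [hσB]; exact hs1)
    (fun k h1 h2 => by rw [hσB]; exact hr3 k h1 h2)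
    (fun k h1 h2 => by rw [hσB]; exact hr4 k h1 (by push_cast; exact h2))
  have hHτ : Ham L q τ ≤ 2 * L + 1 := by
    rcases e2 with ⟨_, rfl⟩ | h <;> omega
  have hτA : ∀ m, τ (A m) ≠ a := fun m => by rw [e4 _ (fun k => l.disj m k)]; exact hσA m
  have o2 : ∀ v, v ∉ U → τ v = a := fun v hv => by
    rw [e4 v (fun n h => hv (h ▸ hBU n))]; exact hout' v hv
  have htA' : ∀ m, τ (tA m) = a := by
    intro n
    rcases Int.emod_two_eq_zero_or_one n with h | h
    · exact o2 _ (htA n h)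
    · rw [l.oA n h]; exact e3 n
  have hfl2 := l.rA.flip hL τ 0 a
  rw [htA', DD_ne (hτA 0), DD_self] at hfl2
  have d1 := DD_le a (τ (A (0 - 1)))
  have d2 := DD_le a (τ (A (0 + 1)))
  set τ' := Function.update τ (A 0) a with hτ'
  have hm : ∀ v, τ v = a → τ' v = a := by
    intro v hv; by_cases h : v = A 0
    · rw [h, hτ']; simp
    · rw [hτ', Function.update_of_ne h, hv]
  obtain ⟨ρ, g1, g2, g3, g4⟩ := descend' hL l.rA U a hAU τ' (by omega) (fun v hv => hm _ (o2 v hv))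
    (fun n => hm _ (htA' n)) 0 (by simp [hτ'])
  have : ρ = groundConf L q a := by
    funext v
    by_cases hv : ∃ n, v = A n
    · obtain ⟨k, rfl⟩ := hv; exact g3 k
    · have hv' := hv
      push Not at hv'
      rw [g4 v hv']
      apply hm
      by_cases hw : ∃ n, v = B n
      · obtain ⟨k, rfl⟩ := hw; exact e3 k
      · apply o2; rw [hU0]; rintro (h | h)
        · exact hv h
        · exact hw h
  rw [← this]
  have p2 := Reach.step _ _ _ _ (by omega) o2 (oneFlip_update τ _ _ (hτA 0)) g1
  have p1 := Reach.step _ _ _ _ hH hout (oneFlip_update σ (A n) b (by rw [hna]; exact hba.symm))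
    (e1.trans p2)
  exact p1.mono _ (by omega)

lemma ladder_main {L q : ℕ} [NeZero L] (hL : 8 ≤ L) {A tA B tB : ℤ → Site L}
    (l : Ladder L A tA B tB) (U : Set (Site L))
    (hU0 : U = {v | (∃ n, v = A n) ∨ ∃ n, v = B n})
    (a : Fin q) (σ : Conf L q) (hH : Ham L q σ ≤ 2 * L + 2)
    (hout : ∀ v, v ∉ U → σ v = a)
    (S : LState (2 * L) a (fun n => σ (A n)) (fun n => σ (B n)))
    (n : ℤ) (hn : 2 ≤ DD (σ (A n)) (σ (A (n - 1))) + DD (σ (A n)) (σ (A (n + 1))) +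
      DD (σ (A n)) (σ (tA n))) :
    Reach U a (4 * L) σ (groundConf L q a) := by
  have htA : n % 2 = 0 → σ (tA n) = a := by
    intro hn
    apply hout
    intro h
    rw [hU0] at h
    rcases h with ⟨k, h⟩ | ⟨k, h⟩
    · exact l.rA.tne _ _ h
    · exact l.eA n hn _ h
  have hw1 := S.w1 n
  have hw1m := S.w1 (n - 1)
  have hw2 := S.w2 n
  have hw3 := S.w3 n
  rw [sub_add_cancel] at hw1m
  by_cases hna : σ (A n) = a
  · have : σ (A (n - 1)) ≠ a ∧ σ (A (n + 1)) ≠ a := by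
      rcases Int.emod_two_eq_zero_or_one n with h | h
      · rw [htA h, hna] at hn
        unfold DD at hn
        grind
      · rw [l.oA n h] at hn
        unfold DD at hn
        grind
    exact ladder_a hL l U hU0 a σ hH hout S n hna this.1 this.2
  · have h3 : σ (tA n) = a ∨ σ (tA n) = σ (A n) := by
      rcases Int.emod_two_eq_zero_or_one n with h | h
      · exact Or.inl (htA h)
      · rw [l.oA n h]; by_cases hg : σ (B n) = a
        · exact Or.inl hg
        · exact Or.inr (hw2 h hna hg).symm
    by_cases hp : σ (A (n - 1)) = a
    · refine ladder_b hL l U hU0 a σ hH hout S n hna hp ?_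
      unfold DD at hn
      grind
    · have hx : σ (A (n + 1)) = a ∧ σ (tA n) = a := by
        unfold DD at hn
        grind
      refine ladder_b hL l.neg U ?_ a σ hH hout S.neg (-n) (by simpa using hna) ?_ ?_
      · rw [hU0]; ext v
        constructor
        · rintro (⟨k, h⟩ | ⟨k, h⟩)
          · exact Or.inl ⟨-k, by simpa using h⟩
          · exact Or.inr ⟨-k, by simpa using h⟩
        · rintro (⟨k, h⟩ | ⟨k, h⟩)
          · exact Or.inl ⟨_, h⟩
          · exact Or.inr ⟨_, h⟩
      · rw [show -(-n - 1) = n + 1 by ring]; exact hx.1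
      · right; simpa using hx.2


/-- The horizontal strip `j`, enumerated by the integers. -/
def cc (L : ℕ) (j : ZMod L) (n : ℤ) : Site L := ((((n / 2 : ℤ) : ZMod L), j), decide (n % 2 = 1))

/-- Third neighbour of the site `cc L j n`. -/
def tt (L : ℕ) (j : ZMod L) (n : ℤ) : Site L :=
  if n % 2 = 0 then cc L (j - 1) (n + 1) else cc L (j + 1) (n - 1)

lemma cc_even (L : ℕ) (j : ZMod L) (m : ℤ) : cc L j (2 * m) = (((m : ZMod L), j), false) := by
  unfold cc
  rw [show 2 * m / 2 = m by omega, show 2 * m % 2 = 0 by omega]; simp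

lemma cc_odd (L : ℕ) (j : ZMod L) (m : ℤ) : cc L j (2 * m + 1) = (((m : ZMod L), j), true) := by
  unfold cc
  rw [show (2 * m + 1) / 2 = m by omega, show (2 * m + 1) % 2 = 1 by omega]; simp

lemma cc_row (L : ℕ) (j : ZMod L) (n : ℤ) : (cc L j n).1.2 = j := rfl

lemma cc_surj {L : ℕ} [NeZero L] (v : Site L) : ∃ n, v = cc L v.1.2 n := by
  obtain ⟨⟨i, j⟩, b⟩ := v
  have hi : (((i.val : ℕ) : ℤ) : ZMod L) = i := by simp
  cases b
  · exact ⟨2 * (i.val : ℤ), by rw [cc_even, hi]⟩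
  · exact ⟨2 * (i.val : ℤ) + 1, by rw [cc_odd, hi]⟩

lemma small_ne {L : ℕ} (p : ℤ) (h0 : 0 < p) (h1 : p < L) : (p : ZMod L) ≠ 0 := by
  intro h
  rw [ZMod.intCast_zmod_eq_zero_iff_dvd] at h
  have := Int.le_of_dvd h0 h
  omega

lemma one_ne {L : ℕ} (hL : 8 ≤ L) : (1 : ZMod L) ≠ 0 := by
  have := small_ne (L := L) 1 (by norm_num) (by omega)
  simpa using this

lemma two_ne {L : ℕ} (hL : 8 ≤ L) : (2 : ZMod L) ≠ 0 := by
  have := small_ne (L := L) 2 (by norm_num) (by omega)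
  simpa using this

lemma tt_row {L : ℕ} (j : ZMod L) (n : ℤ) :
    (tt L j n).1.2 = if n % 2 = 0 then j - 1 else j + 1 := by
  unfold tt; split_ifs <;> rfl

lemma ring_cc {L : ℕ} (hL : 8 ≤ L) (j : ZMod L) : IsRing L (cc L j) (tt L j) where
  adj n v := by
    obtain ⟨⟨i, k⟩, b⟩ := v
    rcases Int.emod_two_eq_zero_or_one n with h | h
    · obtain ⟨m, rfl⟩ : ∃ m, n = 2 * m := ⟨n / 2, by omega⟩
      unfold tt
      rw [if_pos h, cc_even, cc_odd, cc_odd, show 2 * m - 1 = 2 * (m - 1) + 1 by ring, cc_odd]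
      cases b <;> simp [hexAdj]
      tauto
    · obtain ⟨m, rfl⟩ : ∃ m, n = 2 * m + 1 := ⟨n / 2, by omega⟩
      unfold tt
      rw [if_neg (by omega), cc_odd, show 2 * m + 1 - 1 = 2 * m by ring, cc_even, cc_even,
        show 2 * m + 1 + 1 = 2 * (m + 1) by ring, cc_even]
      cases b <;> simp [hexAdj, eq_sub_iff_add_eq]
      grind
  per n := by
    unfold cc
    rw [show (n + 2 * (L : ℤ)) / 2 = n / 2 + L by omega,
      show (n + 2 * (L : ℤ)) % 2 = n % 2 by omega]
    simp
  inj n k h0 h1 h := by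
    unfold cc at h
    simp only [Prod.mk.injEq, and_true, decide_eq_decide] at h
    obtain ⟨h2, h3⟩ := h
    have hk : k % 2 = 0 := by
      by_contra hc
      by_cases hn : n % 2 = 1
      · have := h3.2 hn; omega
      · have : (n + k) % 2 = 1 := by omega
        exact hn (h3.1 this)
    obtain ⟨p, rfl⟩ : ∃ p, k = 2 * p := ⟨k / 2, by omega⟩
    rw [show (n + 2 * p) / 2 = n / 2 + p by omega] at h2
    push_cast at h2
    exact small_ne (L := L) p (by omega) (by omega) (by simpa using h2)
  tne n m h := by
    have h1 := congrArg (fun v : Site L => v.1.2) h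
    simp only [tt_row, cc_row] at h1
    have := one_ne hL
    split_ifs at h1 <;> simp_all

lemma IsRing.shift {L : ℕ} {c t : ℤ → Site L} (R : IsRing L c t) (d : ℤ) :
    IsRing L (fun n => c (n + d)) (fun n => t (n + d)) where
  adj n v := by
    rw [R.adj, show n - 1 + d = n + d - 1 by ring, show n + 1 + d = n + d + 1 by ring]
  per n := by
    have := R.per (n + d)
    rw [show n + 2 * (L : ℤ) + d = n + d + 2 * L by ring]; exact this
  inj n k h0 h1 := by
    have := R.inj (n + d) k h0 h1
    rw [show n + k + d = n + d + k by ring]; exact this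
  tne n m := R.tne _ _

lemma ladder_cc {L : ℕ} (hL : 8 ≤ L) (j : ZMod L) :
    Ladder L (cc L j) (tt L j) (fun n => cc L (j + 1) (n + (-1)))
      (fun n => tt L (j + 1) (n + (-1))) where
  rA := ring_cc hL j
  rB := (ring_cc hL (j + 1)).shift (-1)
  disj n m h := by
    have h1 := congrArg (fun v : Site L => v.1.2) h
    simp only [cc_row] at h1
    apply one_ne hL
    linear_combination -h1
  oA n hn := by unfold tt; rw [if_neg (by omega)]; rfl
  oB n hn := by unfold tt; rw [if_pos (by omega)]; simp
  eA n hn m h := by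
    have h1 := congrArg (fun v : Site L => v.1.2) h
    simp only [cc_row, tt_row] at h1
    rw [if_pos hn] at h1
    apply two_ne hL
    linear_combination -h1
  eB n hn m h := by
    have h1 := congrArg (fun v : Site L => v.1.2) h
    simp only [cc_row, tt_row] at h1
    rw [if_neg (by omega)] at h1
    apply two_ne hL
    linear_combination h1

/-- Energy of a cyclic sequence. -/
def cycE {q : ℕ} (M : ℕ) (f : ℤ → Fin q) : ℕ := ∑ k ∈ Finset.range M, DD (f k) (f (k + 1))

lemma sum_shift (M : ℕ) (h : ℤ → ℕ) (hp : ∀ n, h (n + M) = h n) (s : ℤ) :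
    ∑ k ∈ Finset.range M, h (s + k) = ∑ k ∈ Finset.range M, h k := by
  have step : ∀ s : ℤ, ∑ k ∈ Finset.range M, h (s + 1 + k) = ∑ k ∈ Finset.range M, h (s + k) := by
    intro s
    have h1 := Finset.sum_range_succ (fun k : ℕ => h (s + k)) M
    have h2 := Finset.sum_range_succ' (fun k : ℕ => h (s + k)) M
    rw [h1] at h2
    simp only [hp] at h2
    simp only [Nat.cast_zero, add_zero, add_left_inj] at h2
    rw [h2]
    apply Finset.sum_congr rfl
    intro k _
    congr 1; push_cast; ring
  induction s using Int.induction_on with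
  | zero => simp
  | succ i ih => rw [step, ih]
  | pred i ih => rw [← ih, ← step (-(i : ℤ) - 1)]; simp

lemma cycE_shift {q : ℕ} (M : ℕ) (f : ℤ → Fin q) (hp : ∀ n, f (n + M) = f n) (s : ℤ) :
    ∑ k ∈ Finset.range M, DD (f (s + k)) (f (s + k + 1)) = cycE M f := by
  apply sum_shift M (fun n => DD (f n) (f (n + 1)))
  intro n
  simp only [hp, show n + (M : ℤ) + 1 = n + 1 + M by ring]

lemma cycE_two {q : ℕ} (M : ℕ) (hM : M ≠ 0) (f : ℤ → Fin q) (hp : ∀ n, f (n + M) = f n)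
    (hc : ∃ n, f n ≠ f (n + 1)) : 2 ≤ cycE M f := by
  obtain ⟨n, hn⟩ := hc
  by_contra hlt
  rw [← cycE_shift M f hp n] at hlt
  cases M with
  | zero => exact hM rfl
  | succ M =>
    rw [Finset.sum_range_succ'] at hlt
    have h0 : DD (f (n + (0 : ℕ))) (f (n + (0 : ℕ) + 1)) = 1 := by simpa using DD_ne hn
    rw [h0] at hlt
    have hz : ∑ k ∈ Finset.range M, DD (f (n + ((k + 1 : ℕ) : ℤ))) (f (n + ((k + 1 : ℕ) : ℤ) + 1)) = 0 := by
      omega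
    rw [Finset.sum_eq_zero_iff] at hz
    have key : ∀ k : ℕ, k ≤ M → f (n + 1 + k) = f (n + 1) := by
      intro k
      induction k with
      | zero => intro _; simp
      | succ k ih =>
        intro hk
        have h1 := hz k (by simp; omega)
        rw [← ih (by omega)]
        by_contra hne
        rw [DD_ne] at h1
        · omega
        · intro h2; apply hne
          rw [show n + 1 + ((k + 1 : ℕ) : ℤ) = n + ((k + 1 : ℕ) : ℤ) + 1 by push_cast; ring, ← h2]
          congr 1; push_cast; ring
    have h1 := key M le_rfl
    have h2 := hp n
    rw [show n + ((M + 1 : ℕ) : ℤ) = n + 1 + M by push_cast; ring, h1] at h2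
    exact hn h2.symm

lemma cycE_noThree {q : ℕ} (M : ℕ) (f : ℤ → Fin q) (hp : ∀ n, f (n + M) = f n)
    (hE : cycE M f ≤ 2) : NoThree M f := by
  intro s k₁ k₂ k₃ h0 h1 h2 h3 e1 e2 e3
  obtain ⟨k₁, rfl⟩ := Int.eq_ofNat_of_zero_le h0
  obtain ⟨k₂, rfl⟩ := Int.eq_ofNat_of_zero_le (by omega : 0 ≤ k₂)
  obtain ⟨k₃, rfl⟩ := Int.eq_ofNat_of_zero_le (by omega : 0 ≤ k₃)
  rw [← cycE_shift M f hp s] at hE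
  have hsub : ({k₁, k₂, k₃} : Finset ℕ) ⊆ Finset.range M := by
    intro k hk
    simp only [Finset.mem_insert, Finset.mem_singleton] at hk
    simp only [Finset.mem_range]
    omega
  have := Finset.sum_le_sum_of_subset (f := fun k : ℕ => DD (f (s + k)) (f (s + k + 1))) hsub
  rw [Finset.sum_insert (by simp; omega), Finset.sum_insert (by simp; omega),
    Finset.sum_singleton, DD_ne e1, DD_ne e2, DD_ne e3] at this
  omega

lemma sum_zmod {L : ℕ} [NeZero L] (F : ZMod L → ℕ) :
    ∑ k ∈ Finset.range L, F (k : ZMod L) = ∑ i : ZMod L, F i := by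
  refine Finset.sum_nbij' (fun k => (k : ZMod L)) (fun i => i.val) ?_ ?_ ?_ ?_ ?_
  · intro _ _; simp
  · intro i _; simpa using ZMod.val_lt i
  · intro k hk; simp at hk; simp [ZMod.val_natCast, Nat.mod_eq_of_lt hk]
  · intro i _; simp
  · intro _ _; rfl

lemma sum_double (L : ℕ) (h : ℕ → ℕ) :
    ∑ k ∈ Finset.range (2 * L), h k = ∑ k ∈ Finset.range L, (h (2 * k) + h (2 * k + 1)) := by
  induction L with
  | zero => simp
  | succ L ih =>
    rw [show 2 * (L + 1) = 2 * L + 1 + 1 by ring, Finset.sum_range_succ, Finset.sum_range_succ, ih,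
      Finset.sum_range_succ]
    ring

lemma rowE_eq {L q : ℕ} [NeZero L] (σ : Conf L q) (j : ZMod L) :
    cycE (2 * L) (fun n => σ (cc L j n)) =
      ∑ i : ZMod L, (DD (σ ((i, j), false)) (σ ((i, j), true)) +
        DD (σ ((i, j), false)) (σ ((i - 1, j), true))) := by
  unfold cycE
  rw [sum_double]
  have : ∀ k : ℕ, DD (σ (cc L j ((2 * k : ℕ) : ℤ))) (σ (cc L j (((2 * k : ℕ) : ℤ) + 1))) +
      DD (σ (cc L j ((2 * k + 1 : ℕ) : ℤ))) (σ (cc L j (((2 * k + 1 : ℕ) : ℤ) + 1))) =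
      (fun i : ZMod L => DD (σ ((i, j), false)) (σ ((i, j), true)) +
        DD (σ ((i + 1, j), false)) (σ ((i, j), true))) (k : ZMod L) := by
    intro k
    have h1 := cc_even L j k
    have h2 := cc_odd L j k
    have h3 := cc_even L j (k + 1)
    push_cast at *
    rw [show 2 * (k : ℤ) + 1 + 1 = 2 * (k + 1) by ring, h1, h2, h3]
    congr 1
    simp only [DD, eq_comm]
  rw [Finset.sum_congr rfl (fun k _ => this k)]
  rw [sum_zmod (fun i : ZMod L => DD (σ ((i, j), false)) (σ ((i, j), true)) +
        DD (σ ((i + 1, j), false)) (σ ((i, j), true)))]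
  rw [Finset.sum_add_distrib, Finset.sum_add_distrib]
  congr 1
  exact Fintype.sum_equiv (Equiv.addRight (1 : ZMod L)) _ _ (fun i => by simp)

lemma Ham_sum {L q : ℕ} [NeZero L] (hL : 8 ≤ L) (σ : Conf L q) :
    Ham L q σ = ∑ i : ZMod L, ∑ j : ZMod L, (DD (σ ((i, j), false)) (σ ((i, j), true)) +
      DD (σ ((i, j), false)) (σ ((i - 1, j), true)) +
      DD (σ ((i, j), false)) (σ ((i, j - 1), true))) := by
  rw [Ham_eq, Finset.sum_filter, Fintype.sum_prod_type, Fintype.sum_prod_type,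
    Fintype.sum_prod_type]
  apply Finset.sum_congr rfl; intro i _
  apply Finset.sum_congr rfl; intro j _
  rw [Fintype.sum_bool]
  simp only [Bool.true_eq_false, false_and, if_false, Finset.sum_const_zero, zero_add, true_and]
  rw [← Finset.sum_filter]
  have : (Finset.univ : Finset (Site L)).filter (fun w => hexAdj ((i, j), false) w) =
      {((i, j), true), ((i - 1, j), true), ((i, j - 1), true)} := by
    ext ⟨⟨x, y⟩, b⟩
    cases b <;> simp [hexAdj]
  have h1 := one_ne hL
  have h2 : ∀ x : ZMod L, ¬ x = x - 1 := fun x h => h1 (by linear_combination h)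
  rw [this, Finset.sum_insert (by simp [h2]), Finset.sum_insert (by simp [h1]),
    Finset.sum_singleton]
  ring


/-- Lattice symmetry exchanging horizontal and vertical strips. -/
def phi1 {L : ℕ} (v : Site L) : Site L := ((v.1.2, v.1.1), v.2)

/-- Lattice symmetry exchanging horizontal and diagonal strips. -/
def phi2 {L : ℕ} (v : Site L) : Site L :=
  ((v.1.1, (if v.2 = true then -1 else 0) - v.1.1 - v.1.2), v.2)

lemma two_Ham {L q : ℕ} [NeZero L] (hL : 8 ≤ L) (σ : Conf L q) :
    2 * Ham L q σ = (∑ j : ZMod L, cycE (2 * L) (fun n => σ (cc L j n))) +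
      (∑ j : ZMod L, cycE (2 * L) (fun n => σ (phi1 (cc L j n)))) +
      (∑ j : ZMod L, cycE (2 * L) (fun n => σ (phi2 (cc L j n)))) := by
  have e0 : ∑ j : ZMod L, cycE (2 * L) (fun n => σ (cc L j n)) =
      ∑ i : ZMod L, ∑ j : ZMod L, (DD (σ ((i, j), false)) (σ ((i, j), true)) +
        DD (σ ((i, j), false)) (σ ((i - 1, j), true))) := by
    rw [Finset.sum_comm]
    exact Finset.sum_congr rfl (fun j _ => rowE_eq σ j)
  have e1 : ∑ j : ZMod L, cycE (2 * L) (fun n => σ (phi1 (cc L j n))) =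
      ∑ i : ZMod L, ∑ j : ZMod L, (DD (σ ((i, j), false)) (σ ((i, j), true)) +
        DD (σ ((i, j), false)) (σ ((i, j - 1), true))) :=
    Finset.sum_congr rfl (fun j _ => rowE_eq (fun v => σ (phi1 v)) j)
  have e2 : ∑ j : ZMod L, cycE (2 * L) (fun n => σ (phi2 (cc L j n))) =
      ∑ i : ZMod L, ∑ j : ZMod L, (DD (σ ((i, j), false)) (σ ((i, j - 1), true)) +
        DD (σ ((i, j), false)) (σ ((i - 1, j), true))) := by
    rw [Finset.sum_congr rfl (fun j _ => rowE_eq (fun v => σ (phi2 v)) j), Finset.sum_comm]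
    apply Finset.sum_congr rfl
    intro i _
    apply Fintype.sum_equiv (Equiv.subLeft (-i))
    intro j
    simp only [phi2, Equiv.subLeft_apply, if_true, Bool.false_eq_true, if_false]
    rw [show (0 : ZMod L) - i - j = -i - j by ring, show (-1 : ZMod L) - i - j = -i - j - 1 by ring,
      show (-1 : ZMod L) - (i - 1) - j = -i - j by ring]
  rw [e0, e1, e2, Ham_sum hL]
  simp only [Finset.sum_add_distrib]
  ring

/-- Consequences of having at most two changes in `a z₁ z₂ z₃ z₄ a`. -/
def Six {q : ℕ} (a z1 z2 z3 z4 : Fin q) : Prop :=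
  (z1 ≠ a → z2 ≠ a → z1 = z2) ∧ (z2 ≠ a → z3 ≠ a → z2 = z3) ∧ (z3 ≠ a → z4 ≠ a → z3 = z4) ∧
  (z2 = a → z1 ≠ a → z3 = a) ∧ (z3 = a → z4 ≠ a → z2 = a)

lemma six_of {q : ℕ} {M : ℤ} (hM : 5 ≤ M) {f : ℤ → Fin q} (h : NoThree M f) (a : Fin q) (s : ℤ)
    (h0 : f s = a) (h5 : f (s + 5) = a) :
    Six a (f (s + 1)) (f (s + 2)) (f (s + 3)) (f (s + 4)) := by
  have key : ∀ x y z : ℤ, 0 ≤ x → x < y → y < z → z < 5 → f (s + x) ≠ f (s + x + 1) →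
      f (s + y) ≠ f (s + y + 1) → f (s + z) ≠ f (s + z + 1) → False :=
    fun x y z h1 h2 h3 h4 => h s x y z h1 h2 h3 (by omega)
  have k012 := key 0 1 2
  have k013 := key 0 1 3
  have k014 := key 0 1 4
  have k023 := key 0 2 3
  have k024 := key 0 2 4
  have k034 := key 0 3 4
  have k123 := key 1 2 3
  have k124 := key 1 2 4
  have k134 := key 1 3 4
  have k234 := key 2 3 4
  clear key
  norm_num [add_assoc] at k012 k013 k014 k023 k024 k034 k123 k124 k134 k234
  rw [h0] at *
  rw [h5] at *
  generalize f (s + 1) = z1 at *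
  generalize f (s + 2) = z2 at *
  generalize f (s + 3) = z3 at *
  generalize f (s + 4) = z4 at *
  unfold Six
  refine ⟨?_, ?_, ?_, ?_, ?_⟩ <;> grind

lemma Six.rev {q : ℕ} {a z1 z2 z3 z4 : Fin q} (h : Six a z1 z2 z3 z4) : Six a z4 z3 z2 z1 := by
  unfold Six at *
  refine ⟨?_, ?_, ?_, ?_, ?_⟩ <;> grind

lemma phi1_cc_even {L : ℕ} (i : ZMod L) (m : ℤ) :
    phi1 (cc L i (2 * m)) = ((i, (m : ZMod L)), false) := by rw [cc_even]; rfl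
lemma phi1_cc_odd {L : ℕ} (i : ZMod L) (m : ℤ) :
    phi1 (cc L i (2 * m + 1)) = ((i, (m : ZMod L)), true) := by rw [cc_odd]; rfl
lemma phi2_cc_even {L : ℕ} (i : ZMod L) (m : ℤ) :
    phi2 (cc L i (2 * m)) = (((m : ZMod L), -m - i), false) := by rw [cc_even]; simp [phi2]
lemma phi2_cc_odd {L : ℕ} (i : ZMod L) (m : ℤ) :
    phi2 (cc L i (2 * m + 1)) = (((m : ZMod L), -1 - m - i), true) := by
  rw [cc_odd]; simp [phi2]

lemma win1 {L q : ℕ} [NeZero L] (hL : 8 ≤ L) (σ : Conf L q) (a : Fin q) (j : ZMod L)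
    (hout : ∀ v : Site L, v.1.2 ≠ j → v.1.2 ≠ j + 1 → σ v = a)
    (hc : ∀ i : ZMod L, NoThree (2 * L) (fun n => σ (phi1 (cc L i n)))) (m : ℤ) :
    Six a (σ (cc L j (2 * m))) (σ (cc L j (2 * m + 1))) (σ (cc L (j + 1) (2 * m)))
      (σ (cc L (j + 1) (2 * m + 1))) := by
  have h1 := one_ne hL
  have h2 := two_ne hL
  have hj : (((j.val : ℕ) : ℤ) : ZMod L) = j := by simp
  set J : ℤ := (j.val : ℤ)
  have := six_of (by omega) (hc (m : ZMod L)) a (2 * (J - 1) + 1) (by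
    rw [phi1_cc_odd]; push_cast; rw [hj]
    apply hout
    · intro h; apply h1; linear_combination -h
    · intro h; apply h2; linear_combination -h) (by
    rw [show 2 * (J - 1) + 1 + 5 = 2 * (J + 2) by ring, phi1_cc_even]; push_cast; rw [hj]
    apply hout
    · intro h; apply h2; linear_combination h
    · intro h; apply h1; linear_combination h)
  rw [show 2 * (J - 1) + 1 + 1 = 2 * J by ring, show 2 * (J - 1) + 1 + 2 = 2 * J + 1 by ring,
    show 2 * (J - 1) + 1 + 3 = 2 * (J + 1) by ring,
    show 2 * (J - 1) + 1 + 4 = 2 * (J + 1) + 1 by ring, phi1_cc_even, phi1_cc_odd, phi1_cc_even,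
    phi1_cc_odd] at this
  push_cast at this
  rw [hj] at this
  rw [cc_even, cc_odd, cc_even, cc_odd]
  exact this

lemma win2 {L q : ℕ} [NeZero L] (hL : 8 ≤ L) (σ : Conf L q) (a : Fin q) (j : ZMod L)
    (hout : ∀ v : Site L, v.1.2 ≠ j → v.1.2 ≠ j + 1 → σ v = a)
    (hc : ∀ i : ZMod L, NoThree (2 * L) (fun n => σ (phi2 (cc L i n)))) (m : ℤ) :
    Six a (σ (cc L j (2 * m))) (σ (cc L j (2 * m - 1))) (σ (cc L (j + 1) (2 * m - 2)))
      (σ (cc L (j + 1) (2 * m - 3))) := by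
  have h1 := one_ne hL
  have h2 := two_ne hL
  have := six_of (by omega) (hc (-m - j : ZMod L)) a (2 * (m - 2)) (by
    rw [phi2_cc_even]; push_cast
    apply hout
    · intro h; apply h2; linear_combination h
    · intro h; apply h1; linear_combination h) (by
    rw [show 2 * (m - 2) + 5 = 2 * m + 1 by ring, phi2_cc_odd]
    apply hout
    · intro h; apply h1; linear_combination -h
    · intro h; apply h2; linear_combination -h)
  apply Six.rev
  rw [show 2 * (m - 2) + 2 = 2 * (m - 1) by ring, show 2 * (m - 2) + 3 = 2 * (m - 1) + 1 by ring,
    show 2 * (m - 2) + 4 = 2 * m by ring, phi2_cc_even, phi2_cc_odd, phi2_cc_even,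
    phi2_cc_odd] at this
  rw [show 2 * m - 1 = 2 * (m - 1) + 1 by ring, show 2 * m - 2 = 2 * (m - 1) by ring,
    show 2 * m - 3 = 2 * (m - 2) + 1 by ring, cc_even, cc_odd, cc_even, cc_odd]
  push_cast at *
  convert this using 5 <;> ring

lemma mk_LState {L q : ℕ} [NeZero L] (hL : 8 ≤ L) (σ : Conf L q) (a : Fin q) (j : ZMod L)
    (hout : ∀ v : Site L, v.1.2 ≠ j → v.1.2 ≠ j + 1 → σ v = a)
    (hA : NoThree (2 * L) (fun n => σ (cc L j n)))
    (hB : NoThree (2 * L) (fun n => σ (cc L (j + 1) n)))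
    (cA : ∃ n, σ (cc L j n) ≠ σ (cc L j (n + 1)))
    (cB : ∃ n, σ (cc L (j + 1) n) ≠ σ (cc L (j + 1) (n + 1)))
    (hc : ∀ i : ZMod L, NoThree (2 * L) (fun n => σ (phi1 (cc L i n))))
    (hd : ∀ i : ZMod L, NoThree (2 * L) (fun n => σ (phi2 (cc L i n)))) :
    LState (2 * L) a (fun n => σ (cc L j n)) (fun n => σ (cc L (j + 1) (n + (-1)))) := by
  have W1 := win1 hL σ a j hout hc
  have W2 := win2 hL σ a j hout hd
  refine ⟨hA, ?_, cA, ?_, ?_, ?_, ?_, ?_, ?_⟩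
  · intro s k₁ k₂ k₃ h0 h1 h2 h3 e1 e2 e3
    refine hB (s - 1) k₁ k₂ k₃ h0 h1 h2 h3 ?_ ?_ ?_
    · rw [show s - 1 + k₁ + 1 = s + k₁ + 1 + -1 by ring, show s - 1 + k₁ = s + k₁ + -1 by ring]; exact e1
    · rw [show s - 1 + k₂ + 1 = s + k₂ + 1 + -1 by ring, show s - 1 + k₂ = s + k₂ + -1 by ring]; exact e2
    · rw [show s - 1 + k₃ + 1 = s + k₃ + 1 + -1 by ring, show s - 1 + k₃ = s + k₃ + -1 by ring]; exact e3
  · obtain ⟨n, hn⟩ := cB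
    refine ⟨n + 1, ?_⟩
    convert hn using 3; ring
    ring
  · intro n
    rcases Int.emod_two_eq_zero_or_one n with h | h
    · have := (W1 (n / 2)).1
      rwa [show 2 * (n / 2) = n by omega] at this
    · have := (W2 ((n + 1) / 2)).1
      rw [show 2 * ((n + 1) / 2) = n + 1 by omega, add_sub_cancel_right] at this
      exact fun h1 h2 => (this h2 h1).symm
  · intro n
    rcases Int.emod_two_eq_zero_or_one n with h | h
    · have := (W2 (n / 2 + 1)).2.2.1
      rw [show 2 * (n / 2 + 1) - 2 = n + 1 + -1 by omega,
        show 2 * (n / 2 + 1) - 3 = n + -1 by omega] at this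
      exact fun h1 h2 => (this h2 h1).symm
    · have := (W1 (n / 2)).2.2.1
      rwa [show 2 * (n / 2) = n + -1 by omega, show n + -1 + 1 = n + 1 + -1 by ring] at this
  · intro n h
    have := (W1 (n / 2)).2.1
    rwa [show 2 * (n / 2) = n + -1 by omega, show n + -1 + 1 = n by ring] at this
  · intro n h h1 h2
    rcases h2 with h2 | h2
    · have := (W1 (n / 2)).2.2.2.1
      rw [show 2 * (n / 2) = n - 1 by omega, show n - 1 + 1 = n by ring] at this
      exact this h1 h2
    · have := (W2 ((n + 1) / 2)).2.2.2.1
      rw [show 2 * ((n + 1) / 2) = n + 1 by omega, add_sub_cancel_right,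
        show n + 1 - 2 = n + -1 by ring] at this
      exact this h1 h2
  · intro n h h1 h2
    rcases h2 with h2 | h2
    · have := (W2 ((n + 1) / 2)).2.2.2.2
      rw [show 2 * ((n + 1) / 2) = n + 1 by omega, add_sub_cancel_right,
        show n + 1 - 2 = n + -1 by ring, show n + 1 - 3 = n - 1 + -1 by ring] at this
      exact this h1 h2
    · have := (W1 (n / 2)).2.2.2.2
      rw [show 2 * (n / 2) = n + -1 by omega, show n + -1 + 1 = n by ring] at this
      exact this h1 (by convert h2 using 3; ring)

lemma far_has_a {L q : ℕ} [NeZero L] (hL : 8 ≤ L) (σ : Conf L q) (a : Fin q) (j j' : ZMod L)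
    (hjj : j ≠ j') (hp : j' ≠ j + 1) (hm : j ≠ j' + 1)
    (hout : ∀ v : Site L, v.1.2 ≠ j → v.1.2 ≠ j' → σ v = a)
    (cB : ∃ n, σ (cc L j' n) ≠ a)
    (hc : ∀ i : ZMod L, NoThree (2 * L) (fun n => σ (phi1 (cc L i n)))) :
    ∃ n, σ (cc L j n) = a := by
  by_contra hno
  push Not at hno
  have h1 := one_ne hL
  obtain ⟨n, hn⟩ := cB
  obtain ⟨m, hm2⟩ : ∃ m : ℤ, m = n / 2 := ⟨_, rfl⟩
  have hj : (((j.val : ℕ) : ℤ) : ZMod L) = j := by simp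
  have ht : ((((j' - j).val : ℕ) : ℤ) : ZMod L) = j' - j := by simp
  have htl : (j' - j).val < L := ZMod.val_lt _
  generalize (j.val : ℕ) = J at hj
  generalize (j' - j).val = t at ht htl
  have ht0 : t ≠ 0 := by
    rintro rfl; apply hjj; simp at ht; linear_combination ht
  have ht1 : t ≠ 1 := by
    rintro rfl; apply hp; simp at ht; linear_combination -ht
  have ht2 : t + 1 ≠ L := by
    intro h
    have : ((t + 1 : ℕ) : ZMod L) = 0 := by rw [h]; simp
    push_cast at this ht
    apply hm; linear_combination -this + ht
  have hJ : ((J + t : ℤ) : ZMod L) = j' := by push_cast at *; rw [hj, ht]; ring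
  have c0 : σ (phi1 (cc L (m : ZMod L) (2 * ((J : ℤ) - 1) + 1))) = a := by
    rw [phi1_cc_odd]; push_cast at *; rw [hj]; apply hout
    · intro h; apply h1; linear_combination -h
    · intro h; apply hm; linear_combination h
  have c1 : σ (phi1 (cc L (m : ZMod L) (2 * (J : ℤ)))) ≠ a := by
    have := hno (2 * m)
    rw [cc_even] at this
    rw [phi1_cc_even, hj]; exact this
  have c2 : σ (phi1 (cc L (m : ZMod L) (2 * (J : ℤ) + 1))) ≠ a := by
    have := hno (2 * m + 1)
    rw [cc_odd] at this
    rw [phi1_cc_odd, hj]; exact this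
  have c3 : σ (phi1 (cc L (m : ZMod L) (2 * ((J : ℤ) + 1)))) = a := by
    rw [phi1_cc_even]; push_cast at *; rw [hj]; apply hout
    · intro h; apply h1; linear_combination h
    · intro h; apply hp; exact h.symm
  have c4 : σ (phi1 (cc L (m : ZMod L) (2 * ((J : ℤ) + t - 1) + 1))) = a := by
    rw [phi1_cc_odd, Int.cast_sub, hJ]; push_cast; apply hout
    · intro h; apply hp; linear_combination h
    · intro h; apply h1; linear_combination -h
  have N := hc (m : ZMod L) (2 * ((J : ℤ) - 1) + 1)
  have N1 := N 0 2 (2 * t) (by omega) (by omega) (by omega) (by omega)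
  have N2 := N 0 2 (2 * t + 1) (by omega) (by omega) (by omega) (by omega)
  have d1 : σ (phi1 (cc L (m : ZMod L) (2 * ((J : ℤ) - 1) + 1 + 0))) ≠
      σ (phi1 (cc L (m : ZMod L) (2 * ((J : ℤ) - 1) + 1 + 0 + 1))) := by
    rw [show 2 * ((J : ℤ) - 1) + 1 + 0 + 1 = 2 * J by ring, add_zero, c0]; exact c1.symm
  have d2 : σ (phi1 (cc L (m : ZMod L) (2 * ((J : ℤ) - 1) + 1 + 2))) ≠
      σ (phi1 (cc L (m : ZMod L) (2 * ((J : ℤ) - 1) + 1 + 2 + 1))) := by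
    rw [show 2 * ((J : ℤ) - 1) + 1 + 2 + 1 = 2 * (J + 1) by ring,
      show 2 * ((J : ℤ) - 1) + 1 + 2 = 2 * J + 1 by ring, c3]; exact c2
  have N1' := N1 d1 d2
  have N2' := N2 d1 d2
  dsimp only at N1' N2'
  rw [show 2 * ((J : ℤ) - 1) + 1 + 2 * t + 1 = 2 * (J + t) by ring,
    show 2 * ((J : ℤ) - 1) + 1 + 2 * t = 2 * (J + t - 1) + 1 by ring, c4] at N1'
  rw [show 2 * ((J : ℤ) - 1) + 1 + (2 * t + 1) + 1 = 2 * (J + t) + 1 by ring,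
    show 2 * ((J : ℤ) - 1) + 1 + (2 * t + 1) = 2 * (J + t) by ring] at N2'
  have e1 : σ (phi1 (cc L (m : ZMod L) (2 * ((J : ℤ) + t)))) = a := by
    by_contra h; exact N1' (fun h' => h h'.symm)
  have e2 : σ (phi1 (cc L (m : ZMod L) (2 * ((J : ℤ) + t) + 1))) = a := by
    by_contra h; exact N2' (fun h' => h (by rw [← h', e1]))
  rw [phi1_cc_even, hJ] at e1
  rw [phi1_cc_odd, hJ] at e2
  apply hn
  rcases Int.emod_two_eq_zero_or_one n with h | h
  · rw [show n = 2 * m by omega, cc_even]; exact e1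
  · rw [show n = 2 * m + 1 by omega, cc_odd]; exact e2


/-- The first alternative of the dichotomy. -/
def StarP (L q : ℕ) (σ : Conf L q) (a : Fin q) : Prop :=
  ∃ (N : ℕ) (ω : ℕ → Conf L q), N ≤ 4 * L ∧ ω 0 = σ ∧ ω N = groundConf L q a ∧
    (∀ n < N, oneFlip (ω n) (ω (n + 1))) ∧
    (∀ n ≤ N, Ham L q (ω n) ≤ 2 * L + 2) ∧
    ∀ n ≤ N,
      L - 2 ≤ Nat.card {p : Fin 3 × ZMod L // IsBridgeWith L q (ω n) p.1 p.2 a}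

/-- The second alternative of the dichotomy. -/
def IsoP (L q : ℕ) (σ : Conf L q) : Prop :=
  ∀ ζ : Conf L q, ConnBelow L q (2 * L + 2) σ ζ → ζ = σ

lemma const_of_step {q : ℕ} (f : ℤ → Fin q) (h : ∀ n, f n = f (n + 1)) (n : ℤ) : f n = f 0 := by
  induction n using Int.induction_on with
  | zero => rfl
  | succ i ih => rw [← h]; exact ih
  | pred i ih => rw [h (-(i : ℤ) - 1), sub_add_cancel]; exact ih

lemma row_bridge {L q : ℕ} [NeZero L] (σ : Conf L q) (j : ZMod L) (c : Fin q)
    (h : ∀ n, σ (cc L j n) = c) : IsBridgeWith L q σ 0 j c := by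
  intro v hv
  have hv : v.1.2 = j := by simpa [stripSet] using hv
  obtain ⟨n, hn⟩ := cc_surj v
  rw [hn, hv]; exact h n

lemma row_nonconst {L q : ℕ} [NeZero L] (σ : Conf L q) (j : ZMod L)
    (h : ∀ c, ¬ IsBridgeWith L q σ 0 j c) : ∃ n, σ (cc L j n) ≠ σ (cc L j (n + 1)) := by
  by_contra hc
  push Not at hc
  exact h _ (row_bridge σ j _ (const_of_step (fun n => σ (cc L j n)) hc))

lemma phi1_strip {L : ℕ} (v : Site L) (ℓ : ZMod L) :
    (v ∈ stripSet L 0 ℓ ↔ phi1 v ∈ stripSet L 1 ℓ) ∧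
    (v ∈ stripSet L 1 ℓ ↔ phi1 v ∈ stripSet L 0 ℓ) ∧
    (v ∈ stripSet L 2 ℓ ↔ phi1 v ∈ stripSet L 2 ℓ) := by
  refine ⟨by simp [stripSet, phi1], by simp [stripSet, phi1], ?_⟩
  simp [stripSet, phi1, add_comm]

lemma phi2_strip {L : ℕ} (v : Site L) (ℓ : ZMod L) :
    (v ∈ stripSet L 0 ℓ ↔ phi2 v ∈ stripSet L 2 (-ℓ)) ∧
    (v ∈ stripSet L 2 ℓ ↔ phi2 v ∈ stripSet L 0 (-ℓ)) ∧
    (v ∈ stripSet L 1 ℓ ↔ phi2 v ∈ stripSet L 1 ℓ) := by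
  obtain ⟨⟨i, j⟩, b⟩ := v
  cases b
  · refine ⟨?_, ?_, by simp [stripSet, phi2]⟩
    · simp only [stripSet, phi2]; simp
      constructor
      · rintro rfl; ring
      · intro h; linear_combination -h
    · simp only [stripSet, phi2]; simp
      constructor
      · rintro rfl; ring
      · intro h; linear_combination -h
  · refine ⟨?_, ?_, by simp [stripSet, phi2]⟩
    · simp only [stripSet, phi2]; simp
      constructor
      · rintro rfl; ring
      · intro h; linear_combination -h
    · simp only [stripSet, phi2]; simp
      constructor
      · intro h; linear_combination -h
      · intro h; linear_combination -h

lemma phi1_inv {L : ℕ} (v : Site L) : phi1 (phi1 v) = v := rfl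

lemma phi2_inv {L : ℕ} (v : Site L) : phi2 (phi2 v) = v := by
  obtain ⟨⟨i, j⟩, b⟩ := v
  cases b <;> simp [phi2]

/-- A lattice symmetry together with the induced map on strips. -/
structure Sym (L : ℕ) (φ : Site L → Site L) (Ψ : Fin 3 × ZMod L → Fin 3 × ZMod L) : Prop where
  inv : ∀ v, φ (φ v) = v
  snd : ∀ v, (φ v).2 = v.2
  adj : ∀ v w, hexAdj v w → hexAdj (φ v) (φ w)
  psi : ∀ p, Ψ (Ψ p) = p
  strip : ∀ v p, v ∈ stripSet L p.1 p.2 ↔ φ v ∈ stripSet L (Ψ p).1 (Ψ p).2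

def psi1 (L : ℕ) (p : Fin 3 × ZMod L) : Fin 3 × ZMod L :=
  if p.1 = 0 then (1, p.2) else if p.1 = 1 then (0, p.2) else p

def psi2 (L : ℕ) (p : Fin 3 × ZMod L) : Fin 3 × ZMod L :=
  if p.1 = 0 then (2, -p.2) else if p.1 = 2 then (0, -p.2) else p

lemma sym1 (L : ℕ) : Sym L phi1 (psi1 L) where
  inv := phi1_inv
  snd v := rfl
  adj v w h := by
    obtain ⟨⟨i, j⟩, b⟩ := v
    obtain ⟨⟨i', j'⟩, b'⟩ := w
    simp only [hexAdj, phi1, Prod.mk.injEq] at *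
    tauto
  psi p := by
    obtain ⟨d, ℓ⟩ := p
    fin_cases d <;> simp [psi1]
  strip v p := by
    obtain ⟨d, ℓ⟩ := p
    have := phi1_strip v ℓ
    fin_cases d
    · exact this.1
    · exact this.2.1
    · exact this.2.2

lemma sym2 (L : ℕ) : Sym L phi2 (psi2 L) where
  inv := phi2_inv
  snd v := rfl
  adj v w h := by
    obtain ⟨⟨i, j⟩, b⟩ := v
    obtain ⟨⟨i', j'⟩, b'⟩ := w
    simp only [hexAdj, phi2, Prod.mk.injEq] at *
    rcases h with ⟨rfl, rfl, h⟩ | ⟨rfl, rfl, h⟩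
    · left
      refine ⟨rfl, rfl, ?_⟩
      rcases h with ⟨rfl, rfl⟩ | ⟨rfl, rfl⟩ | ⟨rfl, rfl⟩
      · right; right; simp; ring
      · right; left; simp; ring
      · left; simp; ring
    · right
      refine ⟨rfl, rfl, ?_⟩
      rcases h with ⟨rfl, rfl⟩ | ⟨rfl, rfl⟩ | ⟨rfl, rfl⟩
      · right; right; simp; ring
      · right; left; simp; ring
      · left; simp; ring
  psi p := by
    obtain ⟨d, ℓ⟩ := p
    fin_cases d <;> simp [psi2]
  strip v p := by
    obtain ⟨d, ℓ⟩ := p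
    have := phi2_strip v ℓ
    fin_cases d
    · exact this.1
    · exact this.2.2
    · exact this.2.1

lemma Sym.ham {L q : ℕ} [NeZero L] {φ : Site L → Site L} {Ψ} (S : Sym L φ Ψ) (σ : Conf L q) :
    Ham L q (fun v => σ (φ v)) = Ham L q σ := by
  rw [Ham_eq, Ham_eq]
  refine Finset.sum_nbij' (fun e => (φ e.1, φ e.2)) (fun e => (φ e.1, φ e.2)) ?_ ?_ ?_ ?_ ?_
  · rintro ⟨v, w⟩ h
    simp only [Finset.mem_filter, Finset.mem_univ, true_and] at *
    exact ⟨by rw [S.snd]; exact h.1, S.adj _ _ h.2⟩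
  · rintro ⟨v, w⟩ h
    simp only [Finset.mem_filter, Finset.mem_univ, true_and] at *
    exact ⟨by rw [S.snd]; exact h.1, S.adj _ _ h.2⟩
  · rintro ⟨v, w⟩ h; simp [S.inv]
  · rintro ⟨v, w⟩ h; simp [S.inv]
  · rintro ⟨v, w⟩ h; rfl

lemma Sym.bridge {L q : ℕ} {φ : Site L → Site L} {Ψ} (S : Sym L φ Ψ) (σ : Conf L q)
    (p : Fin 3 × ZMod L) (c : Fin q) :
    IsBridgeWith L q (fun v => σ (φ v)) p.1 p.2 c ↔ IsBridgeWith L q σ (Ψ p).1 (Ψ p).2 c := by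
  constructor
  · intro h v hv
    have := h (φ v) (by rw [S.strip, S.inv]; exact hv)
    simpa [S.inv] using this
  · intro h v hv
    exact h (φ v) ((S.strip _ _).1 hv)

lemma Sym.flip {L q : ℕ} {φ : Site L → Site L} {Ψ} (S : Sym L φ Ψ) {σ ζ : Conf L q}
    (h : oneFlip σ ζ) : oneFlip (fun v => σ (φ v)) (fun v => ζ (φ v)) := by
  obtain ⟨x, h1, h2⟩ := h
  refine ⟨φ x, by simpa [S.inv] using h1, fun y hy => h2 _ ?_⟩
  rintro rfl
  exact hy (S.inv y).symm

lemma Sym.star {L q : ℕ} [NeZero L] {φ : Site L → Site L} {Ψ} (S : Sym L φ Ψ) (σ : Conf L q)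
    (a : Fin q) (h : StarP L q (fun v => σ (φ v)) a) : StarP L q σ a := by
  obtain ⟨N, ω, h1, h2, h3, h4, h5, h6⟩ := h
  refine ⟨N, fun n v => ω n (φ v), h1, ?_, ?_, fun n hn => S.flip (h4 n hn), ?_, ?_⟩
  · funext v; simp [h2, S.inv]
  · funext v; simp [h3, groundConf]
  · intro n hn; rw [S.ham]; exact h5 n hn
  · intro n hn
    refine (h6 n hn).trans (le_of_eq ?_)
    apply Nat.card_congr
    refine ⟨fun p => ⟨Ψ p.1, ?_⟩, fun p => ⟨Ψ p.1, ?_⟩, ?_, ?_⟩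
    · rw [S.bridge, S.psi]; exact p.2
    · rw [← S.bridge]; exact p.2
    · intro p; simp [S.psi]
    · intro p; simp [S.psi]

lemma Sym.iso {L q : ℕ} [NeZero L] {φ : Site L → Site L} {Ψ} (S : Sym L φ Ψ) (σ : Conf L q)
    (h : IsoP L q (fun v => σ (φ v))) : IsoP L q σ := by
  rintro ζ ⟨N, ω, h1, h2, h3, h4⟩
  have := h (fun v => ζ (φ v)) ⟨N, fun n v => ω n (φ v), by subst h1; rfl, by subst h2; rfl,
    fun n hn => S.flip (h3 n hn), fun n hn => by rw [S.ham]; exact h4 n hn⟩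
  funext v
  have := congrFun this (φ v)
  simpa [S.inv] using this

lemma isolated {L q : ℕ} [NeZero L] (hL : 8 ≤ L) (σ : Conf L q) (hH : Ham L q σ = 2 * L + 2)
    (h : ∀ j n, DD (σ (cc L j n)) (σ (cc L j (n - 1))) + DD (σ (cc L j n)) (σ (cc L j (n + 1))) +
      DD (σ (cc L j n)) (σ (tt L j n)) ≤ 1) : IsoP L q σ := by
  rintro ζ ⟨N, ω, h1, h2, h3, h4⟩
  have key : ∀ n ≤ N, ω n = σ := by
    intro n
    induction n with
    | zero => intro _; exact h1
    | succ n ih =>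
      intro hn
      exfalso
      have e := ih (by omega)
      obtain ⟨x, f1, f2⟩ := h3 n (by omega)
      rw [e] at f1 f2
      obtain ⟨m, hm⟩ := cc_surj x
      generalize x.1.2 = j at hm
      have hu : ω (n + 1) = Function.update σ x (ω (n + 1) x) := by
        funext y
        by_cases hy : y = x
        · subst hy; simp
        · rw [Function.update_of_ne hy, f2 y hy]
      have hle := h4 (n + 1) hn
      rw [hu] at hle
      generalize ω (n + 1) x = b at f1 hle
      subst hm
      have g1 := (ring_cc hL j).flip hL σ m b
      have g2 := h j m
      have d1 : DD (σ (cc L j m)) b = 1 := DD_ne f1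
      have tri : ∀ z, 1 ≤ DD (σ (cc L j m)) z + DD b z := by
        intro z
        by_contra hz
        have z1 : DD (σ (cc L j m)) z = 0 := by omega
        have z2 : DD b z = 0 := by omega
        unfold DD at z1 z2
        split_ifs at z1 z2 with z3 z4
        exact f1 (z3.trans z4.symm)
      have t1 := tri (σ (cc L j (m - 1)))
      have t2 := tri (σ (cc L j (m + 1)))
      have t3 := tri (σ (tt L j m))
      omega
  rw [← h2]; exact key N le_rfl

lemma star_of_reach {L q : ℕ} [NeZero L] (σ : Conf L q) (a : Fin q) (j j' : ZMod L)
    (U : Set (Site L)) (hU : ∀ v ∈ U, v.1.2 = j ∨ v.1.2 = j')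
    (h : Reach U a (4 * L) σ (groundConf L q a)) : StarP L q σ a := by
  obtain ⟨N, ω, h1, h2, h3, h4, h5, h6⟩ := h.path
  refine ⟨N, ω, h1, h2, h3, h4, h5, fun n hn => ?_⟩
  have hb : ∀ ℓ, ℓ ≠ j → ℓ ≠ j' → IsBridgeWith L q (ω n) 0 ℓ a := by
    intro ℓ hl hl' v hv
    have hv : v.1.2 = ℓ := by simpa [stripSet] using hv
    apply h6 n hn
    intro hvU
    rcases hU v hvU with e | e
    · exact hl (hv ▸ e)
    · exact hl' (hv ▸ e)
  have hc : L - 2 ≤ ((Finset.univ : Finset (ZMod L)) \ {j, j'}).card := by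
    have e1 := Finset.le_card_sdiff ({j, j'} : Finset (ZMod L)) Finset.univ
    have e2 : ({j, j'} : Finset (ZMod L)).card ≤ 2 := Finset.card_le_two
    rw [Finset.card_univ, ZMod.card] at e1
    omega
  refine hc.trans ?_
  have hi : Function.Injective (fun x : ((Finset.univ : Finset (ZMod L)) \ {j, j'} : Finset _) =>
      (⟨(0, x.1), by
        have hx := x.2
        simp only [Finset.mem_sdiff, Finset.mem_univ, true_and, Finset.mem_insert,
          Finset.mem_singleton, not_or] at hx
        exact hb x.1 hx.1 hx.2⟩ :
        {p : Fin 3 × ZMod L // IsBridgeWith L q (ω n) p.1 p.2 a})) := by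
    intro x y hxy
    simp only [Subtype.mk.injEq, Prod.mk.injEq, true_and] at hxy
    exact Subtype.ext hxy
  have := Nat.card_le_card_of_injective _ hi
  rwa [Nat.card_eq_fintype_card, Fintype.card_coe] at this

lemma sum_tight {L : ℕ} [NeZero L] (F : ZMod L → ℕ) (h : ∀ i, 2 ≤ F i)
    (hs : ∑ i, F i ≤ 2 * L) (i : ZMod L) : F i ≤ 2 := by
  by_contra hc
  have := Finset.sum_lt_sum (s := Finset.univ) (f := fun _ : ZMod L => 2) (g := F)
    (fun i _ => h i) ⟨i, Finset.mem_univ _, by omega⟩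
  simp [ZMod.card] at this
  omega

lemma sum_low {L : ℕ} [NeZero L] (F : ZMod L → ℕ) (h : ∀ i, 2 ≤ F i) : 2 * L ≤ ∑ i, F i := by
  have := Finset.sum_le_sum (s := Finset.univ) (f := fun _ : ZMod L => 2) (g := F)
    (fun i _ => h i)
  simp [ZMod.card] at this
  omega

lemma per_cc {L : ℕ} (hL : 8 ≤ L) (j : ZMod L) (n : ℤ) :
    cc L j (n + ((2 * L : ℕ) : ℤ)) = cc L j n := by
  push_cast
  exact (ring_cc hL j).per n

/-- Two adjacent nonconstant rows. -/
lemma core_adj {L q : ℕ} [NeZero L] (hL : 8 ≤ L) (σ : Conf L q) (a : Fin q)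
    (hH : Ham L q σ = 2 * L + 2) (j : ZMod L)
    (hout : ∀ v : Site L, v.1.2 ≠ j → v.1.2 ≠ j + 1 → σ v = a)
    (hA : NoThree (2 * L) (fun n => σ (cc L j n)))
    (hB : NoThree (2 * L) (fun n => σ (cc L (j + 1) n)))
    (cA : ∃ n, σ (cc L j n) ≠ σ (cc L j (n + 1)))
    (cB : ∃ n, σ (cc L (j + 1) n) ≠ σ (cc L (j + 1) (n + 1)))
    (hc : ∀ i : ZMod L, NoThree (2 * L) (fun n => σ (phi1 (cc L i n))))
    (hd : ∀ i : ZMod L, NoThree (2 * L) (fun n => σ (phi2 (cc L i n)))) :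
    StarP L q σ a ∨ IsoP L q σ := by
  have S := mk_LState hL σ a j hout hA hB cA cB hc hd
  by_cases hiso : ∀ k n, DD (σ (cc L k n)) (σ (cc L k (n - 1))) +
      DD (σ (cc L k n)) (σ (cc L k (n + 1))) + DD (σ (cc L k n)) (σ (tt L k n)) ≤ 1
  · exact Or.inr (isolated hL σ hH hiso)
  left
  push Not at hiso
  obtain ⟨k, n, hn⟩ := hiso
  have hcov : ∀ v : Site L, (v.1.2 = j ↔ ∃ n, v = cc L j n) := by
    intro v
    constructor
    · rintro rfl; exact cc_surj v
    · rintro ⟨n, rfl⟩; rfl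
  have hcov' : ∀ v : Site L, (v.1.2 = j + 1 ↔ ∃ n, v = cc L (j + 1) (n + (-1))) := by
    intro v
    constructor
    · intro h
      obtain ⟨n, hn⟩ := cc_surj v
      exact ⟨n + 1, by rw [add_neg_cancel_right, ← h]; exact hn⟩
    · rintro ⟨n, rfl⟩; rfl
  have hkk : k = j ∨ k = j + 1 := by
    by_contra hk
    push Not at hk
    have e0 : ∀ m, σ (cc L k m) = a := fun m => hout _ hk.1 hk.2
    rw [e0, e0, e0, DD_self] at hn
    have := DD_le a (σ (tt L k n))
    omega
  rcases hkk with rfl | rfl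
  · refine star_of_reach σ a k (k + 1) {v | (∃ n, v = cc L k n) ∨
      ∃ n, v = cc L (k + 1) (n + (-1))} ?_ ?_
    · rintro v (h | h)
      · exact Or.inl ((hcov v).2 h)
      · exact Or.inr ((hcov' v).2 h)
    · refine ladder_main hL (ladder_cc hL k) _ rfl a σ hH.le ?_ S n (by omega)
      intro v hv
      apply hout
      · exact fun h => hv (Or.inl ((hcov v).1 h))
      · exact fun h => hv (Or.inr ((hcov' v).1 h))
  · refine star_of_reach σ a j (j + 1) {v | (∃ n, v = cc L (j + 1) (n + (-1))) ∨
      ∃ n, v = cc L j n} ?_ ?_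
    · rintro v (h | h)
      · exact Or.inr ((hcov' v).2 h)
      · exact Or.inl ((hcov v).2 h)
    · refine ladder_main hL (ladder_cc hL j).swap _ rfl a σ hH.le ?_ S.swap (n + 1) ?_
      · intro v hv
        apply hout
        · exact fun h => hv (Or.inr ((hcov v).1 h))
        · exact fun h => hv (Or.inl ((hcov' v).1 h))
      · rw [show n + 1 + -1 = n by ring, show n + 1 - 1 + -1 = n - 1 by ring,
          show n + 1 + 1 + -1 = n + 1 by ring]
        omega

lemma core {L q : ℕ} [NeZero L] (hL : 8 ≤ L) (σ : Conf L q) (a : Fin q)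
    (hH : Ham L q σ = 2 * L + 2)
    (h0 : ∀ ℓ c, IsBridgeWith L q σ 0 ℓ c → c = a)
    (h1 : ∀ ℓ c, ¬ IsBridgeWith L q σ 1 ℓ c)
    (h2 : ∀ ℓ c, ¬ IsBridgeWith L q σ 2 ℓ c) :
    StarP L q σ a ∨ IsoP L q σ := by
  have hM : 2 * L ≠ 0 := by omega
  have n1 : ∀ i : ZMod L, ∃ n, σ (phi1 (cc L i n)) ≠ σ (phi1 (cc L i (n + 1))) := fun i =>
    row_nonconst (fun v => σ (phi1 v)) i
      (fun c hb => h1 i c (((sym1 L).bridge σ (0, i) c).1 hb))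
  have n2 : ∀ i : ZMod L, ∃ n, σ (phi2 (cc L i n)) ≠ σ (phi2 (cc L i (n + 1))) := fun i =>
    row_nonconst (fun v => σ (phi2 v)) i
      (fun c hb => h2 (-i) c (((sym2 L).bridge σ (0, i) c).1 hb))
  have e1 : ∀ i : ZMod L, 2 ≤ cycE (2 * L) (fun n => σ (phi1 (cc L i n))) := fun i =>
    cycE_two _ hM _ (fun n => by simp only [per_cc hL]) (n1 i)
  have e2 : ∀ i : ZMod L, 2 ≤ cycE (2 * L) (fun n => σ (phi2 (cc L i n))) := fun i =>
    cycE_two _ hM _ (fun n => by simp only [per_cc hL]) (n2 i)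
  have s1 := sum_low _ e1
  have s2 := sum_low _ e2
  have tot := two_Ham hL σ
  rw [hH] at tot
  set K : Finset (ZMod L) := Finset.univ.filter
    (fun j => ∃ n, σ (cc L j n) ≠ σ (cc L j (n + 1))) with hK
  have hKE : ∀ j ∈ K, 2 ≤ cycE (2 * L) (fun n => σ (cc L j n)) := by
    intro j hj
    rw [hK, Finset.mem_filter] at hj
    exact cycE_two _ hM _ (fun n => by simp only [per_cc hL]) hj.2
  have hKs : ∑ j ∈ K, cycE (2 * L) (fun n => σ (cc L j n)) ≤
      ∑ j : ZMod L, cycE (2 * L) (fun n => σ (cc L j n)) :=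
    Finset.sum_le_sum_of_subset (Finset.subset_univ _)
  have hKc : K.card * 2 ≤ ∑ j ∈ K, cycE (2 * L) (fun n => σ (cc L j n)) := by
    have := Finset.sum_le_sum hKE
    simpa using this
  have hKout : ∀ v : Site L, v.1.2 ∉ K → σ v = a := by
    intro v hv
    rw [hK, Finset.mem_filter] at hv
    push Not at hv
    have hv := hv (Finset.mem_univ _)
    have hb := row_bridge σ v.1.2 _ (const_of_step (fun n => σ (cc L v.1.2 n)) hv)
    rw [hb v (by simp [stripSet]), h0 _ _ hb]
  have hKnc : ∀ j ∈ K, ∃ n, σ (cc L j n) ≠ σ (cc L j (n + 1)) := by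
    intro j hj
    rw [hK, Finset.mem_filter] at hj
    exact hj.2
  clear_value K
  have hcard : K.card ≤ 2 := by omega
  have hcases : K.card = 0 ∨ K.card = 1 ∨ K.card = 2 := by omega
  rcases hcases with hc | hc | hc
  · exfalso
    rw [Finset.card_eq_zero] at hc
    subst hc
    exact h1 0 a (fun v _ => hKout v (by simp))
  · left
    rw [Finset.card_eq_one] at hc
    obtain ⟨j, rfl⟩ := hc
    refine star_of_reach σ a j j _ ?_ (single_case hL (ring_cc hL j) a σ hH.le ?_
      (hKnc j (by simp)))
    · rintro v ⟨n, rfl⟩; left; rfl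
    · intro v hv
      apply hKout
      rw [Finset.mem_singleton]
      rintro rfl
      obtain ⟨n, hn⟩ := cc_surj v
      exact hv n hn
  · rw [Finset.card_eq_two] at hc
    obtain ⟨j, j', hjj, rfl⟩ := hc
    have hcd : ({j, j'} : Finset (ZMod L)).card = 2 := Finset.card_pair hjj
    rw [hcd] at hKc
    have t1 := sum_tight _ e1 (by omega)
    have t2 := sum_tight _ e2 (by omega)
    rw [Finset.sum_pair hjj] at hKs
    have a1 := hKE j (by simp)
    have a2 := hKE j' (by simp)
    have rj : NoThree (2 * L) (fun n => σ (cc L j n)) := by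
      have := cycE_noThree (2 * L) (fun n => σ (cc L j n)) (fun n => by simp only [per_cc hL])
        (by omega)
      simpa using this
    have rj' : NoThree (2 * L) (fun n => σ (cc L j' n)) := by
      have := cycE_noThree (2 * L) (fun n => σ (cc L j' n)) (fun n => by simp only [per_cc hL])
        (by omega)
      simpa using this
    have r1 : ∀ i : ZMod L, NoThree (2 * L) (fun n => σ (phi1 (cc L i n))) := by
      intro i
      have := cycE_noThree (2 * L) (fun n => σ (phi1 (cc L i n)))
        (fun n => by simp only [per_cc hL]) (t1 i)
      simpa using this
    have r2 : ∀ i : ZMod L, NoThree (2 * L) (fun n => σ (phi2 (cc L i n))) := by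
      intro i
      have := cycE_noThree (2 * L) (fun n => σ (phi2 (cc L i n)))
        (fun n => by simp only [per_cc hL]) (t2 i)
      simpa using this
    have hout : ∀ v : Site L, v.1.2 ≠ j → v.1.2 ≠ j' → σ v = a := by
      intro v hv hv'
      exact hKout v (by simp [hv, hv'])
    have cj := hKnc j (by simp)
    have cj' := hKnc j' (by simp)
    have nonA : ∀ k, (∃ n, σ (cc L k n) ≠ σ (cc L k (n + 1))) → ∃ n, σ (cc L k n) ≠ a := by
      rintro k ⟨n, hn⟩
      by_contra hcon
      push Not at hcon
      exact hn (by rw [hcon, hcon])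
    by_cases hp : j' = j + 1
    · subst hp
      exact core_adj hL σ a hH j hout rj rj' cj cj' r1 r2
    by_cases hm : j = j' + 1
    · subst hm
      exact core_adj hL σ a hH j' (fun v h h' => hout v h' h) rj' rj cj' cj r1 r2
    left
    have fA := far_has_a hL σ a j j' hjj hp hm hout (nonA j' cj') r1
    have fB := far_has_a hL σ a j' j hjj.symm hm hp (fun v h h' => hout v h' h) (nonA j cj) r1
    have o1 := one_ne hL
    refine star_of_reach σ a j j' {v | (∃ n, v = cc L j n) ∨ ∃ n, v = cc L j' n} ?_ ?_
    · rintro v (⟨n, rfl⟩ | ⟨n, rfl⟩)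
      · left; rfl
      · right; rfl
    · refine (two_far hL (ring_cc hL j) (ring_cc hL j') ?_ _ rfl a σ hH.le ?_ ?_ ?_ fA fB).mono _
        (by omega)
      · intro n m h
        have := congrArg (fun v : Site L => v.1.2) h
        exact hjj this
      · intro v hv
        apply hout
        · rintro rfl; exact hv (Or.inl (cc_surj v))
        · rintro rfl; exact hv (Or.inr (cc_surj v))
      · intro n
        apply hout <;> rw [tt_row] <;> split_ifs
        · intro h; apply o1; linear_combination -h
        · intro h; apply o1; linear_combination h
        · intro h; apply hm; linear_combination h
        · intro h; exact hp h.symm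
      · intro n m h
        have := congrArg (fun v : Site L => v.1.2) h
        simp only [tt_row, cc_row] at this
        split_ifs at this
        · apply hp; linear_combination this
        · exact hm this.symm

lemma dichotomy {L q : ℕ} [NeZero L] (hL : 8 ≤ L) (σ : Conf L q) (a : Fin q) (d₀ : Fin 3)
    (hH : Ham L q σ = 2 * L + 2)
    (hpar : ∀ (d : Fin 3) (ℓ : ZMod L) (c : Fin q),
      IsBridgeWith L q σ d ℓ c → d = d₀ ∧ c = a) : StarP L q σ a ∨ IsoP L q σ := by
  have gen : ∀ (φ : Site L → Site L) (Ψ : Fin 3 × ZMod L → Fin 3 × ZMod L), Sym L φ Ψ →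
      (∀ ℓ, (Ψ (1, ℓ)).1 ≠ d₀) → (∀ ℓ, (Ψ (2, ℓ)).1 ≠ d₀) → StarP L q σ a ∨ IsoP L q σ := by
    intro φ Ψ S g1 g2
    have := core hL (fun v => σ (φ v)) a (by rw [S.ham]; exact hH)
      (fun ℓ c hb => (hpar _ _ _ ((S.bridge σ (0, ℓ) c).1 hb)).2)
      (fun ℓ c hb => g1 ℓ (hpar _ _ _ ((S.bridge σ (1, ℓ) c).1 hb)).1)
      (fun ℓ c hb => g2 ℓ (hpar _ _ _ ((S.bridge σ (2, ℓ) c).1 hb)).1)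
    exact this.imp (S.star σ a) (S.iso σ)
  fin_cases d₀
  · exact gen id id ⟨fun _ => rfl, fun _ => rfl, fun _ _ h => h, fun _ => rfl, fun _ _ => Iff.rfl⟩
      (by simp) (by simp)
  · exact gen _ _ (sym1 L) (by simp [psi1]) (by simp [psi1])
  · exact gen _ _ (sym2 L) (by simp [psi2]) (by simp [psi2])

/-- Lemma 6.9 (hexagonal lattice): if `σ` is of type (MB) — cross-free, `H(σ) = 2L+2`,
with all bridges parallel (direction `d₀`) and of the same spin `a` — then exactly one
of the following holds: (⋆) there is a `(2L+2)`-path of length `≤ 4L` from `σ` to `𝐚`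
whose configurations all have at least `L-2` `a`-bridges; (⋆⋆) `σ` is isolated,
i.e. `N̂(σ) = {σ}`. -/
theorem monochromatic_bridges_dichotomy (L q : ℕ) (hL : 8 ≤ L) (hq : 2 ≤ q)
    (σ : Conf L q) (a : Fin q) (d₀ : Fin 3)
    (hcf : CrossFree L q σ) (hH : Ham L q σ = 2 * L + 2)
    (hpar : ∀ (d : Fin 3) (ℓ : ZMod L) (c : Fin q),
      IsBridgeWith L q σ d ℓ c → d = d₀ ∧ c = a)
    (hex : ∃ ℓ : ZMod L, IsBridgeWith L q σ d₀ ℓ a) :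
    Xor'
      (∃ (N : ℕ) (ω : ℕ → Conf L q), N ≤ 4 * L ∧ ω 0 = σ ∧ ω N = groundConf L q a ∧
        (∀ n < N, oneFlip (ω n) (ω (n + 1))) ∧
        (∀ n ≤ N, Ham L q (ω n) ≤ 2 * L + 2) ∧
        ∀ n ≤ N,
          L - 2 ≤ Nat.card {p : Fin 3 × ZMod L // IsBridgeWith L q (ω n) p.1 p.2 a})
      (∀ ζ : Conf L q, ConnBelow L q (2 * L + 2) σ ζ → ζ = σ) := by


  have : NeZero L := ⟨by omega⟩
  have hnot : ¬ (StarP L q σ a ∧ IsoP L q σ) := by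
    rintro ⟨⟨N, ω, h1, h2, h3, h4, h5, h6⟩, hi⟩
    have hg := hi _ ⟨N, ω, h2, h3, h4, h5⟩
    have b0 := (hpar 0 0 a (fun v _ => by rw [← hg]; rfl)).1
    have b1 := (hpar 1 0 a (fun v _ => by rw [← hg]; rfl)).1
    rw [← b0] at b1
    exact absurd b1 (by decide)
  rcases dichotomy hL σ a d₀ hH hpar with h | h
  · exact Or.inl ⟨h, fun h' => hnot ⟨h, h'⟩⟩
  · exact Or.inr ⟨h, fun h' => hnot ⟨h', h⟩⟩

end IsingHex
end

section
/- On the hexagonal lattice: there exists a constant C > 0 such that for every L ≥ 8, the number of cross-free configurations σ ∈ X with H(σ) ≤ 2L+2 is at most C·L^6. -/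
open scoped Classical BigOperators

namespace IsingHex

section helpers

variable {L q : ℕ} [NeZero L]

theorem zmod_ind (P : ZMod L → Prop) (h0 : P 0) (hs : ∀ x, P x → P (x + 1)) (x : ZMod L) :
    P x := by
  obtain ⟨n, rfl⟩ := ZMod.natCast_zmod_surjective x
  induction n with
  | zero => simpa using h0
  | succ k ih => push_cast; exact hs _ ih

/-- A function on the cycle with at most one jump is constant. -/
theorem const_of_one_jump {α : Type*} (f : ZMod L → α) (t0 : ZMod L)
    (h : ∀ t, t ≠ t0 → f t = f (t - 1)) (t : ZMod L) : f t = f t0 := by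
  have key : ∀ x : ZMod L, f (t0 + x) = f t0 := by
    apply zmod_ind
    · simp
    · intro x hx
      by_cases hc : t0 + (x + 1) = t0
      · rw [hc]
      · rw [h _ hc, ← hx]; congr 1; ring
  have := key (t - t0)
  simpa using this

/-- Two interleaved functions on the cycle with at most one jump are constant. -/
theorem const_of_card {α : Type*} (u d : ZMod L → α)
    (h : (Finset.univ.filter fun t => u t ≠ d t).card
      + (Finset.univ.filter fun t => u t ≠ d (t - 1)).card ≤ 1) :
    ∃ c, ∀ t, u t = c ∧ d t = c := by
  set P := Finset.univ.filter fun t => u t ≠ d t with hP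
  set Q := Finset.univ.filter fun t => u t ≠ d (t - 1) with hQ
  have hPm : ∀ t, t ∉ P → u t = d t := by intro t ht; by_contra hc; exact ht (by simp [hP, hc])
  have hQm : ∀ t, t ∉ Q → u t = d (t - 1) := by
    intro t ht; by_contra hc; exact ht (by simp [hQ, hc])
  rcases Nat.eq_zero_or_pos Q.card with h0 | h0
  · have hQ0 : Q = ∅ := Finset.card_eq_zero.mp h0
    have hQa : ∀ t, u t = d (t - 1) := fun t => hQm t (by simp [hQ0])
    have hP1 : P.card ≤ 1 := by omega
    obtain ⟨t0, ht0⟩ : ∃ t0, P ⊆ {t0} := Finset.card_le_one_iff_subset_singleton.mp hP1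
    have hd := const_of_one_jump d t0 (fun t ht => by
      rw [← hPm t (fun hc => ht (by simpa using ht0 hc)), hQa])
    exact ⟨d t0, fun t => ⟨by rw [hQa, hd], hd t⟩⟩
  · have hP0 : P = ∅ := Finset.card_eq_zero.mp (by omega)
    have hPa : ∀ t, u t = d t := fun t => hPm t (by simp [hP0])
    have hQ1 : Q.card ≤ 1 := by omega
    obtain ⟨t0, ht0⟩ : ∃ t0, Q ⊆ {t0} := Finset.card_le_one_iff_subset_singleton.mp hQ1
    have hd := const_of_one_jump d t0 (fun t ht => by
      rw [← hQm t (fun hc => ht (by simpa using ht0 hc)), hPa])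
    exact ⟨d t0, fun t => ⟨by rw [hPa, hd], hd t⟩⟩

/-- Cells with a disagreement inside the cell. -/
noncomputable def setA (σ : Conf L q) : Finset (ZMod L × ZMod L) :=
  Finset.univ.filter fun p => σ (p, false) ≠ σ (p, true)

/-- Cells with a disagreement across the horizontal shift edge. -/
noncomputable def setB (σ : Conf L q) : Finset (ZMod L × ZMod L) :=
  Finset.univ.filter fun p => σ (p, false) ≠ σ ((p.1 - 1, p.2), true)

/-- Cells with a disagreement across the edge to the previous row. -/
noncomputable def setC (σ : Conf L q) : Finset (ZMod L × ZMod L) :=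
  Finset.univ.filter fun p => σ (p, false) ≠ σ ((p.1, p.2 - 1), true)

theorem mem_setA (σ : Conf L q) (p) : p ∈ setA σ ↔ σ (p, false) ≠ σ (p, true) := by simp [setA]
theorem mem_setB (σ : Conf L q) (p) :
    p ∈ setB σ ↔ σ (p, false) ≠ σ ((p.1 - 1, p.2), true) := by simp [setB]
theorem mem_setC (σ : Conf L q) (p) :
    p ∈ setC σ ↔ σ (p, false) ≠ σ ((p.1, p.2 - 1), true) := by simp [setC]

theorem ham_ge (hL : 2 ≤ L) (σ : Conf L q) :
    (setA σ).card + (setB σ).card + (setC σ).card ≤ Ham L q σ := by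
  haveI : Fact (1 < L) := ⟨hL⟩
  have h1 : (setA σ).card + (setB σ).card + (setC σ).card
      = Nat.card ((setA σ ⊕ setB σ) ⊕ setC σ) := by
    simp
  rw [h1, Ham]
  let F : ((setA σ ⊕ setB σ) ⊕ setC σ) →
      {e : Site L × Site L // e.1.2 = false ∧ hexAdj e.1 e.2 ∧ σ e.1 ≠ σ e.2} := fun s =>
    match s with
    | .inl (.inl p) => ⟨((p.1, false), (p.1, true)), rfl, Or.inl ⟨rfl, rfl, Or.inl rfl⟩,
        (mem_setA σ _).1 p.2⟩
    | .inl (.inr p) => ⟨((p.1, false), ((p.1.1 - 1, p.1.2), true)), rfl,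
        Or.inl ⟨rfl, rfl, Or.inr (Or.inl rfl)⟩, (mem_setB σ _).1 p.2⟩
    | .inr p => ⟨((p.1, false), ((p.1.1, p.1.2 - 1), true)), rfl,
        Or.inl ⟨rfl, rfl, Or.inr (Or.inr rfl)⟩, (mem_setC σ _).1 p.2⟩
  have key : ∀ z : ZMod L, z - 1 ≠ z := by intro z; simp
  apply Nat.card_le_card_of_injective F
  rintro ((⟨⟨a, b⟩, h⟩ | ⟨⟨a, b⟩, h⟩) | ⟨⟨a, b⟩, h⟩) ((⟨⟨a', b'⟩, h'⟩ | ⟨⟨a', b'⟩, h'⟩) | ⟨⟨a', b'⟩, h'⟩) hh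
  all_goals
    simp only [F, Subtype.mk.injEq, Prod.mk.injEq, and_true] at hh
    obtain ⟨⟨h1, h2⟩, h3, h4⟩ := hh
    subst h1 h2
    first
      | rfl
      | exact absurd h3 (key _)
      | exact absurd h4 (key _)
      | exact absurd h3.symm (key _)
      | exact absurd h4.symm (key _)

/-- The relevant class: small energy and no bridge in directions other than `d`. -/
def Good (L q : ℕ) (d : Fin 3) (σ : Conf L q) : Prop :=
  Ham L q σ ≤ 2 * L + 2 ∧ ∀ d', d' ≠ d → ∀ ℓ, ¬ IsBridge L q σ d' ℓ

theorem row_const (σ : Conf L q) (y : ZMod L)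
    (h : ((setA σ).filter fun p => p.2 = y).card + ((setB σ).filter fun p => p.2 = y).card ≤ 1) :
    ∃ c, ∀ x, σ ((x, y), false) = c ∧ σ ((x, y), true) = c := by
  apply const_of_card (fun x => σ ((x, y), false)) (fun x => σ ((x, y), true))
  refine le_trans (Nat.add_le_add ?_ ?_) h
  · apply Finset.card_le_card_of_injOn (fun x => (x, y))
    · intro x hx; simp [setA] at hx ⊢; exact hx
    · intro x _ x' _ h; simpa using h
  · apply Finset.card_le_card_of_injOn (fun x => (x, y))
    · intro x hx; simp [setB] at hx ⊢; exact hx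
    · intro x _ x' _ h; simpa using h

theorem col_const (σ : Conf L q) (x : ZMod L)
    (h : ((setA σ).filter fun p => p.1 = x).card + ((setC σ).filter fun p => p.1 = x).card ≤ 1) :
    ∃ c, ∀ y, σ ((x, y), false) = c ∧ σ ((x, y), true) = c := by
  apply const_of_card (fun y => σ ((x, y), false)) (fun y => σ ((x, y), true))
  refine le_trans (Nat.add_le_add ?_ ?_) h
  · apply Finset.card_le_card_of_injOn (fun y => (x, y))
    · intro x hx; simp [setA] at hx ⊢; exact hx
    · intro x _ x' _ h; simpa using h
  · apply Finset.card_le_card_of_injOn (fun y => (x, y))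
    · intro x hx; simp [setC] at hx ⊢; exact hx
    · intro x _ x' _ h; simpa using h

theorem diag_const (σ : Conf L q) (l : ZMod L)
    (h : ((setC σ).filter fun p => p.1 + p.2 = l).card
      + ((setB σ).filter fun p => p.1 + p.2 = l).card ≤ 1) :
    ∃ c, ∀ x, σ ((x, l - x), false) = c ∧ σ ((x, l - 1 - x), true) = c := by
  apply const_of_card (fun x => σ ((x, l - x), false)) (fun x => σ ((x, l - 1 - x), true))
  refine le_trans (Nat.add_le_add ?_ ?_) h
  · apply Finset.card_le_card_of_injOn (fun x => (x, l - x))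
    · intro x hx
      simp [setC] at hx ⊢
      rwa [show l - x - 1 = l - 1 - x by ring]
    · intro x _ x' _ h; exact congrArg Prod.fst h
  · apply Finset.card_le_card_of_injOn (fun x => (x, l - x))
    · intro x hx
      simp [setB] at hx ⊢
      rwa [show l - x = l - 1 - (x - 1) by ring] at *
    · intro x _ x' _ h; exact congrArg Prod.fst h

theorem sum_bound (f g : ZMod L × ZMod L → ZMod L) (S T : Finset (ZMod L × ZMod L))
    (h : ∀ l, 2 ≤ (S.filter fun p => f p = l).card + (T.filter fun p => g p = l).card) :
    2 * L ≤ S.card + T.card := by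
  have h1 : S.card = ∑ l, (S.filter fun p => f p = l).card :=
    Finset.card_eq_sum_card_fiberwise (fun _ _ => by simp)
  have h2 : T.card = ∑ l, (T.filter fun p => g p = l).card :=
    Finset.card_eq_sum_card_fiberwise (fun _ _ => by simp)
  rw [h1, h2, ← Finset.sum_add_distrib]
  calc 2 * L = ∑ _l : ZMod L, 2 := by simp [ZMod.card, mul_comm]
    _ ≤ _ := Finset.sum_le_sum fun l _ => h l

theorem good_bounds (hL : 8 ≤ L) (σ : Conf L q) (h : Good L q 0 σ) :
    (setA σ).card + (setB σ).card ≤ 4 ∧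
    (setA σ).card + (setB σ).card + (setC σ).card ≤ 2 * L + 2 := by
  obtain ⟨hH, hb⟩ := h
  have h0 := ham_ge (by omega) σ
  have h1 : 2 * L ≤ (setA σ).card + (setC σ).card := by
    apply sum_bound Prod.fst Prod.fst
    intro l
    by_contra hc
    obtain ⟨c, hcc⟩ := col_const σ l (by omega)
    refine hb 1 (by decide) l ⟨c, ?_⟩
    rintro ⟨⟨x, y⟩, b⟩ hv
    simp [stripSet] at hv
    subst hv
    cases b
    · exact (hcc y).1
    · exact (hcc y).2
  have h2 : 2 * L ≤ (setC σ).card + (setB σ).card := by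
    apply sum_bound (fun p => p.1 + p.2) (fun p => p.1 + p.2)
    intro l
    by_contra hc
    obtain ⟨c, hcc⟩ := diag_const σ l (by omega)
    refine hb 2 (by decide) l ⟨c, ?_⟩
    rintro ⟨⟨x, y⟩, b⟩ hv
    simp [stripSet] at hv
    cases b
    · simp at hv
      have := (hcc x).1
      rwa [show l - x = y by rw [← hv]; ring] at this
    · simp at hv
      have := (hcc x).2
      rwa [show l - 1 - x = y by rw [← hv]; ring] at this
  omega

/-- Cells with a horizontal disagreement. -/
noncomputable def setK (σ : Conf L q) : Finset (ZMod L × ZMod L) := setA σ ∪ setB σ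

/-- Non-constant rows. -/
noncomputable def setN (σ : Conf L q) : Finset (ZMod L) := (setK σ).image Prod.snd

/-- Interfaces between two bridges of different colours. -/
noncomputable def setM (σ : Conf L q) : Finset (ZMod L) :=
  Finset.univ.filter fun y => y ∉ setN σ ∧ y + 1 ∉ setN σ ∧
    σ ((0, y), true) ≠ σ ((0, y + 1), true)

theorem not_setK {σ : Conf L q} {p} (h : p ∉ setK σ) :
    σ (p, false) = σ (p, true) ∧ σ (p, false) = σ ((p.1 - 1, p.2), true) := by
  simp only [setK, Finset.mem_union, mem_setA, mem_setB, not_or, not_not] at h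
  exact h

theorem not_setN {σ : Conf L q} {y : ZMod L} (h : y ∉ setN σ) (x : ZMod L) (b : Bool) :
    σ ((x, y), b) = σ ((0, y), true) := by
  have hk : ∀ x, (x, y) ∉ setK σ := fun x hx => h (Finset.mem_image.2 ⟨_, hx, rfl⟩)
  have ht : ∀ x, σ ((x, y), true) = σ ((0, y), true) :=
    const_of_one_jump (fun x => σ ((x, y), true)) 0 (fun t _ => by
      have := not_setK (hk t)
      exact this.1.symm.trans this.2)
  cases b
  · rw [(not_setK (hk x)).1, ht]
  · exact ht x

theorem mem_setN_of {σ : Conf L q} {y : ZMod L} (h : y ∈ setN σ) :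
    2 ≤ ((setA σ).filter fun p => p.2 = y).card + ((setB σ).filter fun p => p.2 = y).card := by
  by_contra hc
  obtain ⟨c, hcc⟩ := row_const σ y (by omega)
  obtain ⟨⟨x, y'⟩, hp, rfl⟩ := Finset.mem_image.1 h
  simp only [setK, Finset.mem_union, mem_setA, mem_setB] at hp
  rcases hp with hp | hp
  · exact hp (by rw [(hcc x).1, (hcc x).2])
  · exact hp (by rw [(hcc x).1, (hcc (x-1)).2])

/-- Reconstruction: configurations are determined by supersets `k`, `m` of the jump
positions and the colours at finitely many sites. -/
theorem reconstruct (k : Fin 4 → ZMod L × ZMod L) (m : Fin 2 → ZMod L) (σ τ : Conf L q)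
    (hσk : ∀ p ∈ setK σ, ∃ i, k i = p) (hτk : ∀ p ∈ setK τ, ∃ i, k i = p)
    (hσm : ∀ y ∈ setM σ, ∃ i, m i = y) (hτm : ∀ y ∈ setM τ, ∃ i, m i = y)
    (h0 : σ ((0, 0), true) = τ ((0, 0), true))
    (hk : ∀ i, ∀ b, σ (k i, b) = τ (k i, b))
    (hk0 : ∀ i, σ ((0, (k i).2), true) = τ ((0, (k i).2), true))
    (hk1 : ∀ i, σ ((0, (k i).2 + 1), true) = τ ((0, (k i).2 + 1), true))
    (hm : ∀ i, σ ((0, m i + 1), true) = τ ((0, m i + 1), true)) : σ = τ := by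
  have base : ∀ y, σ ((0, y), true) = τ ((0, y), true) := by
    apply zmod_ind (fun y => σ ((0, y), true) = τ ((0, y), true)) h0
    intro y hy
    by_cases c1 : ∃ i, (k i).2 = y
    · obtain ⟨i, rfl⟩ := c1; exact hk1 i
    by_cases c2 : ∃ i, (k i).2 = y + 1
    · obtain ⟨i, hi⟩ := c2; rw [← hi]; exact hk0 i
    by_cases c3 : ∃ i, m i = y
    · obtain ⟨i, rfl⟩ := c3; exact hm i
    have key : ∀ ρ : Conf L q, (∀ p ∈ setK ρ, ∃ i, k i = p) → (∀ y ∈ setM ρ, ∃ i, m i = y) →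
        ρ ((0, y), true) = ρ ((0, y + 1), true) := by
      intro ρ h1 h2
      by_contra hne
      apply c3
      apply h2
      simp only [setM, Finset.mem_filter, Finset.mem_univ, true_and]
      refine ⟨?_, ?_, hne⟩
      · intro hN
        obtain ⟨p, hp, hpy⟩ := Finset.mem_image.1 hN
        obtain ⟨i, hi⟩ := h1 p hp
        exact c1 ⟨i, by rw [hi, hpy]⟩
      · intro hN
        obtain ⟨p, hp, hpy⟩ := Finset.mem_image.1 hN
        obtain ⟨i, hi⟩ := h1 p hp
        exact c2 ⟨i, by rw [hi, hpy]⟩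
    rw [← key σ hσk hσm, ← key τ hτk hτm, hy]
  have tr : ∀ y x, σ ((x, y), true) = τ ((x, y), true) := by
    intro y
    apply zmod_ind (fun x => σ ((x, y), true) = τ ((x, y), true)) (base y)
    intro x hx
    by_cases c : ∃ i, k i = (x + 1, y)
    · obtain ⟨i, hi⟩ := c; rw [← hi]; exact hk i true
    · have a1 := not_setK (fun h => c (hσk (x + 1, y) h))
      have a2 := not_setK (fun h => c (hτk (x + 1, y) h))
      simp only [add_sub_cancel_right] at a1 a2
      rw [← a1.1, ← a2.1, a1.2, a2.2, hx]
  funext v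
  obtain ⟨⟨x, y⟩, b⟩ := v
  cases b
  · by_cases c : ∃ i, k i = (x, y)
    · obtain ⟨i, hi⟩ := c; rw [← hi]; exact hk i false
    · have a1 := not_setK (fun h => c (hσk (x, y) h))
      have a2 := not_setK (fun h => c (hτk (x, y) h))
      rw [a1.1, a2.1, tr]
  · exact tr y x

/-- Cells in the four types of encodings. -/
def encK (tag : Fin 4) (v : Fin 6 → ZMod L) : Fin 4 → ZMod L × ZMod L :=
  match tag with
  | 0 => ![(v 1, v 0), (v 2, v 0), (v 3, v 0), (v 3, v 0)]
  | 1 => ![(v 1, v 0), (v 2, v 0), (v 3, v 0), (v 4, v 0)]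
  | 2 => ![(v 2, v 0), (v 3, v 0), (v 4, v 1), (v 5, v 1)]
  | 3 => ![(v 2, v 0), (v 3, v 0), (v 4, v 0 + 1), (v 5, v 0 + 1)]

/-- Interfaces in the four types of encodings. -/
def encM (tag : Fin 4) (v : Fin 6 → ZMod L) : Fin 2 → ZMod L :=
  match tag with
  | 0 => ![v 4, v 5]
  | 1 => ![v 5, v 5]
  | 2 => ![v 0, v 0]
  | 3 => ![v 1, v 1]

theorem subset_pair {α : Type*} [Inhabited α] (S : Finset α) (h : S.card ≤ 2) :
    ∃ a b, ∀ x ∈ S, x = a ∨ x = b := by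
  obtain h1 | h1 := Nat.lt_or_ge S.card 2
  · obtain ⟨t, ht⟩ : ∃ t, S ⊆ {t} := Finset.card_le_one_iff_subset_singleton.mp (by omega)
    exact ⟨t, t, fun x hx => Or.inl (by simpa using ht hx)⟩
  · obtain ⟨a, b, _, rfl⟩ := Finset.card_eq_two.mp (le_antisymm h h1)
    exact ⟨a, b, fun x hx => by simpa using hx⟩

theorem subset_triple {α : Type*} [Inhabited α] (S : Finset α) (h : S.card ≤ 3) :
    ∃ a b c, ∀ x ∈ S, x = a ∨ x = b ∨ x = c := by
  obtain h1 | h1 := Nat.lt_or_ge S.card 3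
  · obtain ⟨a, b, hab⟩ := subset_pair S (by omega)
    exact ⟨a, b, b, fun x hx => by have := hab x hx; tauto⟩
  · obtain ⟨a, b, c, _, _, _, rfl⟩ := Finset.card_eq_three.mp (le_antisymm h h1)
    exact ⟨a, b, c, fun x hx => by simpa using hx⟩

theorem subset_quad {α : Type*} [Inhabited α] (S : Finset α) (h : S.card ≤ 4) :
    ∃ a b c d, ∀ x ∈ S, x = a ∨ x = b ∨ x = c ∨ x = d := by
  rcases S.eq_empty_or_nonempty with rfl | ⟨s, hs⟩
  · exact ⟨default, default, default, default, by simp⟩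
  · obtain ⟨a, b, c, habc⟩ := subset_triple (S.erase s) (by
      rw [Finset.card_erase_of_mem hs]; omega)
    refine ⟨a, b, c, s, fun x hx => ?_⟩
    by_cases hxs : x = s
    · tauto
    · have := habc x (Finset.mem_erase.2 ⟨hxs, hx⟩); tauto

theorem setM_bound (σ : Conf L q) : (setM σ).card * L ≤ (setC σ).card := by
  have : ((setM σ) ×ˢ (Finset.univ : Finset (ZMod L))).card ≤ (setC σ).card := by
    apply Finset.card_le_card_of_injOn (fun p => (p.2, p.1 + 1))
    · rintro ⟨y, x⟩ hp
      simp [setM] at hp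
      simp only [Finset.mem_coe, mem_setC, add_sub_cancel_right]
      rw [not_setN hp.1, not_setN hp.2.1]
      exact fun h => hp.2.2 h.symm
    · rintro ⟨y, x⟩ _ ⟨y', x'⟩ _ h
      simp at h ⊢
      exact ⟨h.2, h.1⟩
  simpa [ZMod.card] using this

/-- Number of vertical disagreements just below row `y`. -/
noncomputable def cRow (σ : Conf L q) (y : ZMod L) : ℕ := ((setC σ).filter fun p => p.2 = y).card

theorem sum_cRow_le (σ : Conf L q) (S : Finset (ZMod L)) :
    ∑ y ∈ S, cRow σ y ≤ (setC σ).card := by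
  have h1 : (setC σ).card = ∑ l, cRow σ l :=
    Finset.card_eq_sum_card_fiberwise (fun _ _ => by simp)
  rw [h1]
  exact Finset.sum_le_sum_of_subset (Finset.subset_univ S)

theorem cRow_of_ne (σ : Conf L q) (y : ZMod L) (h1 : y - 1 ∉ setN σ) (h2 : y + 1 ∉ setN σ)
    (hne : σ ((0, y - 1), true) ≠ σ ((0, y + 1), true)) :
    L ≤ ((setA σ).filter fun p => p.2 = y).card + cRow σ y + cRow σ (y + 1) := by
  set SA := Finset.univ.filter fun x : ZMod L => (x, y) ∈ setA σ with hSA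
  set S1 := Finset.univ.filter fun x : ZMod L => (x, y) ∈ setC σ with hS1
  set S2 := Finset.univ.filter fun x : ZMod L => (x, y + 1) ∈ setC σ with hS2
  have hcov : (Finset.univ : Finset (ZMod L)) ⊆ SA ∪ S1 ∪ S2 := by
    intro x _
    by_contra hx
    simp only [hSA, hS1, hS2, Finset.mem_union, Finset.mem_filter, Finset.mem_univ, true_and,
      mem_setA, mem_setC, not_or, not_not, add_sub_cancel_right] at hx
    obtain ⟨⟨a1, a2⟩, a3⟩ := hx
    rw [not_setN h1] at a2
    rw [not_setN h2] at a3
    exact hne (by rw [← a2, a1, a3])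
  have hc := Finset.card_le_card hcov
  rw [Finset.card_univ, ZMod.card] at hc
  have hu1 := Finset.card_union_le (SA ∪ S1) S2
  have hu2 := Finset.card_union_le SA S1
  have e1 : SA.card ≤ ((setA σ).filter fun p => p.2 = y).card := by
    apply Finset.card_le_card_of_injOn (fun x => (x, y))
    · intro x hx; simp [hSA] at hx ⊢; exact hx
    · intro x _ x' _ h; simpa using h
  have e2 : S1.card ≤ cRow σ y := by
    apply Finset.card_le_card_of_injOn (fun x => (x, y))
    · intro x hx; simp [hS1] at hx ⊢; exact hx
    · intro x _ x' _ h; simpa using h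
  have e3 : S2.card ≤ cRow σ (y + 1) := by
    apply Finset.card_le_card_of_injOn (fun x => (x, y + 1))
    · intro x hx; simp [hS2] at hx ⊢; exact hx
    · intro x _ x' _ h; simpa using h
  omega

theorem cRow_pos (hL : 8 ≤ L) (σ : Conf L q) (y : ZMod L) (h : y ∈ setN σ)
    (h1 : y - 1 ∉ setN σ) (h2 : y + 1 ∉ setN σ)
    (hA : ((setA σ).filter fun p => p.2 = y).card ≤ 4) :
    1 ≤ cRow σ y + cRow σ (y + 1) := by
  by_cases hne : σ ((0, y - 1), true) ≠ σ ((0, y + 1), true)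
  · have := cRow_of_ne σ y h1 h2 hne
    omega
  · push Not at hne
    by_contra hc
    have z1 : cRow σ y = 0 := by omega
    have z2 : cRow σ (y + 1) = 0 := by omega
    simp only [cRow, Finset.card_eq_zero, Finset.filter_eq_empty_iff] at z1 z2
    have w1 : ∀ x, σ ((x, y), false) = σ ((0, y - 1), true) := by
      intro x
      by_contra hh
      refine z1 (x := (x, y)) ?_ rfl
      rw [mem_setC]
      simp only
      rw [not_setN h1]
      exact hh
    have w2 : ∀ x, σ ((x, y), true) = σ ((0, y + 1), true) := by
      intro x
      by_contra hh
      refine z2 (x := (x, y + 1)) ?_ rfl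
      rw [mem_setC]
      simp only [add_sub_cancel_right]
      rw [not_setN h2]
      exact fun h => hh h.symm
    obtain ⟨⟨x, y'⟩, hp, rfl⟩ := Finset.mem_image.1 h
    simp only [setK, Finset.mem_union, mem_setA, mem_setB] at hp
    simp only at w1 w2 hne
    rcases hp with hp | hp
    · exact hp (by rw [w1, w2, hne])
    · exact hp (by rw [w1, w2, hne])

/-- Two separated non-constant rows exclude a further interface. -/
theorem no_interface (hL : 8 ≤ L) (σ : Conf L q)
    (r s m : ZMod L) (hr : r ∈ setN σ) (hs : s ∈ setN σ) (hrs : r ≠ s)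
    (hrs1 : s ≠ r + 1) (hsr1 : r ≠ s + 1) (hN : ∀ y ∈ setN σ, y = r ∨ y = s)
    (hrA : ((setA σ).filter fun p => p.2 = r).card ≤ 2)
    (hsA : ((setA σ).filter fun p => p.2 = s).card ≤ 2)
    (hc : (setC σ).card ≤ 2 * L - 2)
    (hm : m ∈ setM σ) (hM : (setM σ).card ≤ 1) : False := by
  haveI : Fact (1 < L) := ⟨by omega⟩
  have hm' : m ∉ setN σ ∧ m + 1 ∉ setN σ ∧ σ ((0, m), true) ≠ σ ((0, m + 1), true) := by
    simpa [setM] using hm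
  obtain ⟨hm0, hm1, hmne⟩ := hm'
  have hMe : ∀ y ∈ setM σ, y = m := fun y hy => Finset.card_le_one.1 hM y hy m hm
  have r1 : r - 1 ∉ setN σ := by
    intro h; rcases hN _ h with h | h
    · simp at h
    · exact hsr1 (by rw [← h]; ring)
  have r2 : r + 1 ∉ setN σ := by
    intro h; rcases hN _ h with h | h
    · simp at h
    · exact hrs1 h.symm
  have s1 : s - 1 ∉ setN σ := by
    intro h; rcases hN _ h with h | h
    · exact hrs1 (by rw [← h]; ring)
    · simp at h
  have s2 : s + 1 ∉ setN σ := by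
    intro h; rcases hN _ h with h | h
    · exact hsr1 h.symm
    · simp at h
  have Cm : L ≤ cRow σ (m + 1) := by
    have : (Finset.univ : Finset (ZMod L)).card ≤ cRow σ (m + 1) := by
      apply Finset.card_le_card_of_injOn (fun x => (x, m + 1))
      · intro x _
        simp only [Finset.coe_filter, Set.mem_ofPred_eq, mem_setC, add_sub_cancel_right, and_true]
        rw [not_setN hm0, not_setN hm1]
        exact fun h => hmne h.symm
      · intro x _ x' _ h; simpa using h
    simpa [ZMod.card] using this
  have pr := cRow_pos hL σ r hr r1 r2 (by omega)
  have ps := cRow_pos hL σ s hs s1 s2 (by omega)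
  have tot := sum_cRow_le σ {m + 1, r, r + 1, s, s + 1}
  have d1 : m + 1 ∉ ({r, r + 1, s, s + 1} : Finset (ZMod L)) := by
    simp only [Finset.mem_insert, Finset.mem_singleton, add_left_inj, not_or]
    refine ⟨?_, ?_, ?_, ?_⟩ <;> intro h
    · exact hm1 (h ▸ hr)
    · exact hm0 (h ▸ hr)
    · exact hm1 (h ▸ hs)
    · exact hm0 (h ▸ hs)
  have d2 : r ∉ ({r + 1, s, s + 1} : Finset (ZMod L)) := by
    simp [hrs, hsr1]
  have d3 : r + 1 ∉ ({s, s + 1} : Finset (ZMod L)) := by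
    simp [hrs, Ne.symm hrs1]
  have d4 : s ∉ ({s + 1} : Finset (ZMod L)) := by simp
  rw [Finset.sum_insert d1, Finset.sum_insert d2, Finset.sum_insert d3, Finset.sum_insert d4,
    Finset.sum_singleton] at tot
  by_cases er : σ ((0, r - 1), true) = σ ((0, r + 1), true)
  swap
  · have := cRow_of_ne σ r r1 r2 er
    omega
  by_cases es : σ ((0, s - 1), true) = σ ((0, s + 1), true)
  swap
  · have := cRow_of_ne σ s s1 s2 es
    omega
  let g : ZMod L → Fin q := fun y =>
    if y ∈ setN σ then σ ((0, y - 1), true) else σ ((0, y), true)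
  have hg := const_of_one_jump g (m + 1) (by
    intro y hy
    by_cases hyN : y ∈ setN σ
    · have hy1 : y - 1 ∉ setN σ := by
        rcases hN y hyN with h | h <;> subst h <;> assumption
      simp [g, hyN, hy1]
    · by_cases hy1 : y - 1 ∈ setN σ
      · simp only [g, hyN, hy1, if_true, if_false]
        rcases hN _ hy1 with h | h
        · rw [h, er, ← h, sub_add_cancel]
        · rw [h, es, ← h, sub_add_cancel]
      · simp only [g, hyN, hy1, if_false]
        by_contra hne
        apply hy
        have : y - 1 = m := hMe _ (by
          simp only [setM, Finset.mem_filter, Finset.mem_univ, true_and, sub_add_cancel]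
          exact ⟨hy1, hyN, fun h => hne h.symm⟩)
        rw [← this, sub_add_cancel]) m
  simp only [g, hm0, hm1, if_false] at hg
  exact hmne hg

/-- Every good configuration admits an encoding. -/
theorem exists_code (hL : 8 ≤ L) (σ : Conf L q) (h : Good L q 0 σ) :
    ∃ (tag : Fin 4) (v : Fin 6 → ZMod L),
      (∀ p ∈ setK σ, ∃ i, encK tag v i = p) ∧ (∀ y ∈ setM σ, ∃ i, encM tag v i = y) := by
  obtain ⟨hab, habc⟩ := good_bounds hL σ h
  have hK : (setK σ).card ≤ (setA σ).card + (setB σ).card := Finset.card_union_le _ _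
  have hMb := setM_bound σ
  have hM2 : (setM σ).card ≤ 2 := by
    by_contra hc
    have : 3 * L ≤ (setM σ).card * L := Nat.mul_le_mul_right _ (by omega)
    omega
  have hM1 : 3 ≤ (setA σ).card + (setB σ).card → (setM σ).card ≤ 1 := by
    intro h3
    by_contra hc
    have : 2 * L ≤ (setM σ).card * L := Nat.mul_le_mul_right _ (by omega)
    omega
  have hKN : ∀ x y, (x, y) ∈ setK σ → y ∈ setN σ :=
    fun x y h => Finset.mem_image.2 ⟨_, h, rfl⟩
  by_cases hN1 : (setN σ).card ≤ 1
  · obtain ⟨r, hr⟩ : ∃ r, setN σ ⊆ {r} := Finset.card_le_one_iff_subset_singleton.mp hN1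
    have hr' : ∀ x y, (x, y) ∈ setK σ → y = r := fun x y h => by simpa using hr (hKN x y h)
    by_cases hK3 : (setK σ).card ≤ 3
    · obtain ⟨a, b, c, habc⟩ := subset_triple _ hK3
      obtain ⟨m, n, hmn⟩ := subset_pair _ hM2
      refine ⟨0, ![r, a.1, b.1, c.1, m, n], ?_, ?_⟩
      · rintro ⟨x, y⟩ hp
        obtain rfl := hr' x y hp
        rcases habc _ hp with h | h | h <;> subst h
        · exact ⟨0, rfl⟩
        · exact ⟨1, rfl⟩
        · exact ⟨2, rfl⟩
      · intro y hy
        rcases hmn y hy with h | h <;> subst h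
        · exact ⟨0, rfl⟩
        · exact ⟨1, rfl⟩
    · obtain ⟨a, b, c, d, habcd⟩ := subset_quad (setK σ) (by omega)
      obtain ⟨n, hn⟩ : ∃ n, setM σ ⊆ {n} :=
        Finset.card_le_one_iff_subset_singleton.mp (hM1 (by omega))
      refine ⟨1, ![r, a.1, b.1, c.1, d.1, n], ?_, ?_⟩
      · rintro ⟨x, y⟩ hp
        obtain rfl := hr' x y hp
        rcases habcd _ hp with h | h | h | h <;> subst h
        · exact ⟨0, rfl⟩
        · exact ⟨1, rfl⟩
        · exact ⟨2, rfl⟩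
        · exact ⟨3, rfl⟩
      · intro y hy
        have : y = n := by simpa using hn hy
        subst this
        exact ⟨0, rfl⟩
  · obtain ⟨r, hr, s, hs, hrs⟩ := Finset.one_lt_card.1 (by omega : 1 < (setN σ).card)
    have sumrows : ∀ S : Finset (ZMod L), ∑ y ∈ S,
        (((setA σ).filter fun p => p.2 = y).card + ((setB σ).filter fun p => p.2 = y).card)
        ≤ (setA σ).card + (setB σ).card := by
      intro S
      have h1 : (setA σ).card = ∑ l, ((setA σ).filter fun p => p.2 = l).card :=
        Finset.card_eq_sum_card_fiberwise (fun _ _ => by simp)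
      have h2 : (setB σ).card = ∑ l, ((setB σ).filter fun p => p.2 = l).card :=
        Finset.card_eq_sum_card_fiberwise (fun _ _ => by simp)
      rw [h1, h2, ← Finset.sum_add_distrib]
      exact Finset.sum_le_sum_of_subset (Finset.subset_univ S)
    have er := mem_setN_of hr
    have es := mem_setN_of hs
    have hrsum := sumrows {r, s}
    rw [Finset.sum_pair hrs] at hrsum
    have hN : ∀ y ∈ setN σ, y = r ∨ y = s := by
      intro y hy
      by_contra hc
      push Not at hc
      have e3 := mem_setN_of hy
      have := sumrows {y, r, s}
      rw [Finset.sum_insert (by simp [hc.1, hc.2]), Finset.sum_pair hrs] at this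
      omega
    have hM1' := hM1 (by omega)
    have hcell : ∀ y, ((setA σ).filter fun p => p.2 = y).card
        + ((setB σ).filter fun p => p.2 = y).card ≤ 2 →
        ∃ a b, ∀ x, (x, y) ∈ setK σ → x = a ∨ x = b := by
      intro y hy
      obtain ⟨a, b, hh⟩ := subset_pair (((setA σ).filter fun p => p.2 = y) ∪
        ((setB σ).filter fun p => p.2 = y)) (le_trans (Finset.card_union_le _ _) hy)
      refine ⟨a.1, b.1, fun x hx => ?_⟩
      have := hh (x, y) (by
        simp only [setK, Finset.mem_union] at hx
        simpa using hx)
      rcases this with h | h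
      · left; rw [← h]
      · right; rw [← h]
    -- the adjacent case, stated once for both orders
    have adj : ∀ r s : ZMod L, s = r + 1 → (∀ y ∈ setN σ, y = r ∨ y = s) →
        ((setA σ).filter fun p => p.2 = r).card + ((setB σ).filter fun p => p.2 = r).card ≤ 2 →
        ((setA σ).filter fun p => p.2 = s).card + ((setB σ).filter fun p => p.2 = s).card ≤ 2 →
        ∃ (tag : Fin 4) (v : Fin 6 → ZMod L),
          (∀ p ∈ setK σ, ∃ i, encK tag v i = p) ∧ (∀ y ∈ setM σ, ∃ i, encM tag v i = y) := by
      intro r s hadj hN' hr2 hs2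
      subst hadj
      obtain ⟨a, b, hab'⟩ := hcell _ hr2
      obtain ⟨c, d, hcd'⟩ := hcell _ hs2
      obtain ⟨n, hn⟩ : ∃ n, setM σ ⊆ {n} := Finset.card_le_one_iff_subset_singleton.mp hM1'
      refine ⟨3, ![r, n, a, b, c, d], ?_, ?_⟩
      · rintro ⟨x, y⟩ hp
        rcases hN' y (hKN x y hp) with h | h <;> subst h
        · rcases hab' x hp with h | h <;> subst h
          · exact ⟨0, rfl⟩
          · exact ⟨1, rfl⟩
        · rcases hcd' x hp with h | h <;> subst h
          · exact ⟨2, rfl⟩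
          · exact ⟨3, rfl⟩
      · intro y hy
        have : y = n := by simpa using hn hy
        subst this
        exact ⟨0, rfl⟩
    by_cases h1 : s = r + 1
    · exact adj r s h1 hN (by omega) (by omega)
    by_cases h2 : r = s + 1
    · exact adj s r h2 (fun y hy => (hN y hy).symm) (by omega) (by omega)
    have hM0 : ∀ m, m ∉ setM σ := fun m hm =>
      no_interface hL σ r s m hr hs hrs h1 h2 hN (by omega) (by omega) (by omega) hm hM1'
    obtain ⟨a, b, hab'⟩ := hcell r (by omega)
    obtain ⟨c, d, hcd'⟩ := hcell s (by omega)
    refine ⟨2, ![r, s, a, b, c, d], ?_, fun y hy => absurd hy (hM0 y)⟩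
    rintro ⟨x, y⟩ hp
    rcases hN y (hKN x y hp) with h | h <;> subst h
    · rcases hab' x hp with h | h <;> subst h
      · exact ⟨0, rfl⟩
      · exact ⟨1, rfl⟩
    · rcases hcd' x hp with h | h <;> subst h
      · exact ⟨2, rfl⟩
      · exact ⟨3, rfl⟩

/-- The finite colour information. -/
abbrev Colors (q : ℕ) : Type :=
  Fin q × (Fin 4 → Bool → Fin q) × (Fin 4 → Fin q) × (Fin 4 → Fin q) × (Fin 2 → Fin q)

theorem good_zero_card (hL : 8 ≤ L) :
    Nat.card {σ : Conf L q // Good L q 0 σ} ≤ Nat.card (Colors q) * 4 * L ^ 6 := by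
  choose tag v hk hm using fun σ : {σ : Conf L q // Good L q 0 σ} => exists_code hL σ.1 σ.2
  let F : {σ : Conf L q // Good L q 0 σ} → (Colors q × Fin 4) × (Fin 6 → ZMod L) := fun σ =>
    (((σ.1 ((0, 0), true),
      fun i b => σ.1 (encK (tag σ) (v σ) i, b),
      fun i => σ.1 ((0, (encK (tag σ) (v σ) i).2), true),
      fun i => σ.1 ((0, (encK (tag σ) (v σ) i).2 + 1), true),
      fun i => σ.1 ((0, encM (tag σ) (v σ) i + 1), true)), tag σ), v σ)
  have hF : Function.Injective F := by
    intro σ τ hh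
    simp only [F, Prod.mk.injEq] at hh
    obtain ⟨⟨⟨h0, h1, h2, h3, h4⟩, ht⟩, hv⟩ := hh
    rw [ht, hv] at h1 h2 h3 h4
    have a1 := hk σ
    have a2 := hm σ
    rw [ht, hv] at a1 a2
    apply Subtype.ext
    exact reconstruct (encK (tag τ) (v τ)) (encM (tag τ) (v τ)) σ.1 τ.1 a1 (hk τ) a2 (hm τ) h0
      (fun i b => congrFun (congrFun h1 i) b) (fun i => congrFun h2 i) (fun i => congrFun h3 i)
      (fun i => congrFun h4 i)
  have := Nat.card_le_card_of_injective F hF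
  rw [Nat.card_prod, Nat.card_prod (Colors q), Nat.card_fun] at this
  simpa [Nat.card_zmod] using this

theorem ham_comp (φ : Site L ≃ Site L) (h2 : ∀ v, (φ v).2 = v.2)
    (hadj : ∀ v w, hexAdj (φ v) (φ w) ↔ hexAdj v w) (σ : Conf L q) :
    Ham L q (σ ∘ φ) = Ham L q σ := by
  unfold Ham
  apply Nat.card_congr
  refine (Equiv.prodCongr φ φ).subtypeEquiv ?_
  rintro ⟨a, b⟩
  simp [h2, hadj]

theorem good_card_of_sym (d : Fin 3) (φ : Site L ≃ Site L) (h2 : ∀ v, (φ v).2 = v.2)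
    (hadj : ∀ v w, hexAdj (φ v) (φ w) ↔ hexAdj v w)
    (hstrip : ∀ d', d' ≠ 0 → ∀ ℓ, ∃ d'' ℓ', d'' ≠ d ∧
      ∀ v, v ∈ stripSet L d'' ℓ' → φ.symm v ∈ stripSet L d' ℓ) :
    Nat.card {σ : Conf L q // Good L q d σ} ≤ Nat.card {σ : Conf L q // Good L q 0 σ} := by
  apply Nat.card_le_card_of_injective
    (fun σ => (⟨σ.1 ∘ φ, by
      refine ⟨by rw [ham_comp φ h2 hadj]; exact σ.2.1, ?_⟩
      rintro d' hd' ℓ ⟨a, ha⟩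
      obtain ⟨d'', ℓ', hd, hs⟩ := hstrip d' hd' ℓ
      refine σ.2.2 d'' hd ℓ' ⟨a, fun v hv => ?_⟩
      simpa using ha _ (hs v hv)⟩ : {σ : Conf L q // Good L q 0 σ}))
  intro σ τ h
  apply Subtype.ext
  have h' := congrArg Subtype.val h
  funext v
  simpa using congrFun h' (φ.symm v)

/-- The reflection exchanging the horizontal and vertical directions. -/
def symSwap (L : ℕ) : Site L ≃ Site L where
  toFun v := ((v.1.2, v.1.1), v.2)
  invFun v := ((v.1.2, v.1.1), v.2)
  left_inv v := rfl
  right_inv v := rfl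

/-- The reflection exchanging the horizontal and diagonal directions. -/
def symDiag (L : ℕ) : Site L ≃ Site L where
  toFun v := ((v.1.1, -v.1.1 - v.1.2 - (if v.2 then 1 else 0)), v.2)
  invFun v := ((v.1.1, -v.1.1 - v.1.2 - (if v.2 then 1 else 0)), v.2)
  left_inv v := by
    obtain ⟨⟨x, y⟩, b⟩ := v
    simp only [Prod.mk.injEq, true_and, and_true]
    ring
  right_inv v := by
    obtain ⟨⟨x, y⟩, b⟩ := v
    simp only [Prod.mk.injEq, true_and, and_true]
    ring

theorem good_one_card : Nat.card {σ : Conf L q // Good L q 1 σ} ≤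
    Nat.card {σ : Conf L q // Good L q 0 σ} := by
  apply good_card_of_sym 1 (symSwap L) (fun v => rfl)
  · rintro ⟨⟨x, y⟩, b⟩ ⟨⟨x', y'⟩, b'⟩
    simp only [hexAdj, symSwap, Equiv.coe_fn_mk, Prod.mk.injEq]
    tauto
  · intro d' hd' ℓ
    fin_cases d'
    · simp at hd'
    · refine ⟨0, ℓ, by decide, ?_⟩
      rintro ⟨⟨x, y⟩, b⟩ hv
      simpa [stripSet, symSwap] using hv
    · refine ⟨2, ℓ, by decide, ?_⟩
      rintro ⟨⟨x, y⟩, b⟩ hv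
      simp [stripSet, symSwap] at hv ⊢
      rwa [add_comm y x]

theorem good_two_card : Nat.card {σ : Conf L q // Good L q 2 σ} ≤
    Nat.card {σ : Conf L q // Good L q 0 σ} := by
  apply good_card_of_sym 2 (symDiag L) (fun v => rfl)
  · rintro ⟨⟨x, y⟩, b⟩ ⟨⟨x', y'⟩, b'⟩
    cases b <;> cases b' <;> simp only [hexAdj, symDiag, Equiv.coe_fn_mk, Prod.mk.injEq] <;> grind
  · intro d' hd' ℓ
    fin_cases d'
    · simp at hd'
    · refine ⟨1, ℓ, by decide, ?_⟩
      rintro ⟨⟨x, y⟩, b⟩ hv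
      simpa [stripSet, symDiag] using hv
    · refine ⟨0, -ℓ, by decide, ?_⟩
      rintro ⟨⟨x, y⟩, b⟩ hv
      simp [stripSet] at hv
      subst hv
      cases b <;> simp [stripSet, symDiag] <;> ring

theorem exists_in_both (d d' : Fin 3) (h : d ≠ d') (ℓ ℓ' : ZMod L) :
    ∃ v, v ∈ stripSet L d ℓ ∧ v ∈ stripSet L d' ℓ' := by
  fin_cases d <;> fin_cases d' <;> simp at h
  · exact ⟨((ℓ', ℓ), false), by simp [stripSet], by simp [stripSet]⟩
  · exact ⟨((ℓ' - ℓ, ℓ), false), by simp [stripSet], by simp [stripSet]⟩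
  · exact ⟨((ℓ, ℓ'), false), by simp [stripSet], by simp [stripSet]⟩
  · exact ⟨((ℓ, ℓ' - ℓ), false), by simp [stripSet], by simp [stripSet]⟩
  · exact ⟨((ℓ - ℓ', ℓ'), false), by simp [stripSet], by simp [stripSet]⟩
  · exact ⟨((ℓ', ℓ - ℓ'), false), by simp [stripSet], by simp [stripSet]⟩

theorem good_of_crossFree (σ : Conf L q) (hc : CrossFree L q σ) (hH : Ham L q σ ≤ 2 * L + 2) :
    ∃ d, Good L q d σ := by
  by_cases hb : ∃ d ℓ, IsBridge L q σ d ℓ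
  · obtain ⟨d, ℓ, a, ha⟩ := hb
    refine ⟨d, hH, ?_⟩
    rintro d' hd' ℓ' ⟨b, hb⟩
    obtain ⟨v, hv, hv'⟩ := exists_in_both d d' hd'.symm ℓ ℓ'
    have : b = a := by rw [← ha v hv, ← hb v hv']
    subst this
    exact hc b ⟨d, d', ℓ, ℓ', hd'.symm, ha, hb⟩
  · push Not at hb
    exact ⟨0, hH, fun d _ ℓ => hb d ℓ⟩

theorem total_card (hL : 8 ≤ L) :
    Nat.card {σ : Conf L q // CrossFree L q σ ∧ Ham L q σ ≤ 2 * L + 2} ≤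
      3 * (Nat.card (Colors q) * 4 * L ^ 6) := by
  choose d hd using fun σ : {σ : Conf L q // CrossFree L q σ ∧ Ham L q σ ≤ 2 * L + 2} =>
    good_of_crossFree σ.1 σ.2.1 σ.2.2
  have h1 := Nat.card_le_card_of_injective
    (fun σ => (⟨d σ, ⟨σ.1, hd σ⟩⟩ : (e : Fin 3) × {σ : Conf L q // Good L q e σ})) (by
      intro σ τ h
      simp only [Sigma.mk.injEq] at h
      obtain ⟨h1, h2⟩ := h
      apply Subtype.ext
      have : ∀ (e e' : Fin 3) (x : {σ : Conf L q // Good L q e σ})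
          (y : {σ : Conf L q // Good L q e' σ}), e = e' → HEq x y → x.1 = y.1 := by
        rintro e _ x y rfl h
        rw [eq_of_heq h]
      exact this _ _ _ _ h1 h2)
  refine le_trans h1 ?_
  rw [Nat.card_sigma, Fin.sum_univ_three]
  have e0 := good_zero_card (q := q) hL
  have e1 := good_one_card (L := L) (q := q)
  have e2 := good_two_card (L := L) (q := q)
  omega

end helpers

/-- Lemma 6.10 (hexagonal lattice): the number of cross-free configurations with energy
at most `2L+2` is `O(L⁶)`. -/
theorem crossfree_count (q : ℕ) (hq : 2 ≤ q) :
    ∃ C : ℝ, 0 < C ∧ ∀ L : ℕ, 8 ≤ L →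
      (Nat.card {σ : Conf L q // CrossFree L q σ ∧ Ham L q σ ≤ 2 * L + 2} : ℝ) ≤
        C * (L : ℝ) ^ 6 := by
  refine ⟨3 * (Nat.card (Colors q) * 4) + 1, by positivity, fun L hL => ?_⟩
  haveI : NeZero L := ⟨by omega⟩
  have h := total_card (L := L) (q := q) hL
  have h' : (Nat.card {σ : Conf L q // CrossFree L q σ ∧ Ham L q σ ≤ 2 * L + 2} : ℝ) ≤
      3 * (Nat.card (Colors q) * 4 * (L : ℝ) ^ 6) := by exact_mod_cast h
  have : (0 : ℝ) ≤ (L : ℝ) ^ 6 := by positivity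
  nlinarith

end IsingHex
end
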